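/- Let d ≥ 1. Let ξ and η be equivariant random measures over the stationary ergodic flow system (Ω, 𝔉, ℙ, θ) with the same finite intensity, which are ℙ-a.s. mutually singular and such that ℙ-a.s. both ξ and η do not charge small sets. Then there exist factor allocations T and S such that T balances ξ and η, S balances η and ξ, and for ℙ-a.e. ω one has S(ω, T(ω, x)) = x for ξ(ω,·)-a.e. x ∈ ℝ^d. -/

import Mathlib

open MeasureTheory Filter Set

noncomputable section

/-- Euclidean space `ℝ^d`. -/
abbrev Eucl (d : ℕ) := EuclideanSpace ℝ (Fin d)

/-- The half-open unit cube `[0,1)^d`. -/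
def unitCube (d : ℕ) : Set (Eucl d) := {x | ∀ i, x i ∈ Set.Ico (0 : ℝ) 1}

/-- `μ` does not charge small sets: it gives no mass to `(d-1)`-rectifiable sets,
i.e. `μ (f '' ℝ^(d-1)) = 0` for every Lipschitz map `f : ℝ^(d-1) → ℝ^d`. -/
def DoesNotChargeSmallSets (d : ℕ) (μ : Measure (Eucl d)) : Prop :=
  ∀ (f : Eucl (d - 1) → Eucl d) (K : NNReal), LipschitzWith K f → μ (Set.range f) = 0

variable {Ω : Type*} [MeasurableSpace Ω]

/-- The σ-algebra `σ(ξ, η)` generated by the measure-valued maps `ξ` and `η`. -/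
def sigmaGen {d : ℕ} (ξ η : Ω → Measure (Eucl d)) : MeasurableSpace Ω :=
  MeasurableSpace.comap ξ inferInstance ⊔ MeasurableSpace.comap η inferInstance

/-- `T` is a factor allocation for `(ξ, η)` over the flow `θ`: it is jointly measurable,
equivariant, and measurable with respect to `σ(ξ, η)` (times the Borel σ-algebra). -/
def IsFactorAllocation {d : ℕ} (θ : Eucl d → Ω → Ω) (ξ η : Ω → Measure (Eucl d))
    (T : Ω → Eucl d → Eucl d) : Prop :=
  Measurable (Function.uncurry T) ∧
  (∀ (ω : Ω) (x y : Eucl d), T (θ x ω) y = T ω (y + x) - x) ∧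
  Measurable[(sigmaGen ξ η).prod (inferInstance : MeasurableSpace (Eucl d))]
    (Function.uncurry T)

set_option linter.unusedSectionVars false

/-- The quantile function of a measure on the line, set to `0` outside `(0, α(ℝ))`. -/
def lineQuantile (α : Measure ℝ) (t : ℝ) : ℝ :=
  open Classical in
  if 0 < t ∧ t < α.real univ then sInf {s | t ≤ α.real (Iic s)} else 0

lemma lineQuantile_le_iff (α : Measure ℝ) [IsFiniteMeasure α] {t : ℝ} (h0 : 0 < t)
    (h1 : t < α.real univ) (s : ℝ) : lineQuantile α t ≤ s ↔ t ≤ α.real (Iic s) := by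
  have hmono : Monotone fun s => α.real (Iic s) := fun a b hab =>
    measureReal_mono (Iic_subset_Iic.2 hab)
  have htop : Tendsto (fun s => α.real (Iic s)) atTop (nhds (α.real univ)) :=
    (ENNReal.tendsto_toReal (measure_ne_top _ _)).comp (tendsto_measure_Iic_atTop α)
  have hbot : Tendsto (fun s => α.real (Iic s)) atBot (nhds 0) := by
    have hI : ⋂ n : ℝ, Iic n = (∅ : Set ℝ) := by
      ext x
      simpa using ⟨x - 1, by linarith⟩
    have := tendsto_measure_iInter_atBot (μ := α) (s := fun n : ℝ => Iic n)
      (fun n => measurableSet_Iic.nullMeasurableSet) (fun a b hab => Iic_subset_Iic.2 hab)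
      ⟨0, measure_ne_top _ _⟩
    rw [hI, measure_empty] at this
    exact (ENNReal.tendsto_toReal ENNReal.zero_ne_top).comp this
  obtain ⟨u, hu⟩ := (htop.eventually (lt_mem_nhds h1)).exists
  obtain ⟨l, hl⟩ := (hbot.eventually (gt_mem_nhds h0)).exists
  have hne : {s | t ≤ α.real (Iic s)}.Nonempty := ⟨u, le_of_lt hu⟩
  have hbdd : BddBelow {s | t ≤ α.real (Iic s)} := by
    refine ⟨l, fun s hs => ?_⟩
    by_contra! hlt
    have := hmono hlt.le
    simp only [mem_ofPred_eq] at hs this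
    linarith
  rw [lineQuantile, if_pos ⟨h0, h1⟩]
  constructor
  · intro hs
    have hright : Tendsto (fun n : ℕ => α.real (Iic (s + 1 / ((n : ℝ) + 1)))) atTop
        (nhds (α.real (Iic s))) := by
      have hI : Iic s = ⋂ n : ℕ, Iic (s + 1 / ((n : ℝ) + 1)) := by
        ext x
        simp only [mem_Iic, mem_iInter]
        refine ⟨fun h n => h.trans (le_add_of_nonneg_right (by positivity)), fun h => ?_⟩
        have : Tendsto (fun n : ℕ => s + 1 / ((n : ℝ) + 1)) atTop (nhds (s + 0)) :=
          tendsto_const_nhds.add tendsto_one_div_add_atTop_nhds_zero_nat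
        rw [add_zero] at this
        exact ge_of_tendsto' this h
      have := tendsto_measure_iInter_atTop (μ := α)
        (s := fun n : ℕ => Iic (s + 1 / ((n : ℝ) + 1)))
        (fun n => measurableSet_Iic.nullMeasurableSet)
        (fun a b hab => Iic_subset_Iic.2
          (by gcongr)) ⟨0, measure_ne_top _ _⟩
      rw [← hI] at this
      exact (ENNReal.tendsto_toReal (measure_ne_top _ _)).comp this
    refine ge_of_tendsto' hright fun n => ?_
    obtain ⟨v, hv, hvlt⟩ := exists_lt_of_csInf_lt hne
      (lt_of_le_of_lt hs (lt_add_of_pos_right s (Nat.one_div_pos_of_nat (n := n) (α := ℝ))))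
    exact le_trans hv (hmono hvlt.le)
  · exact fun hs => csInf_le hbdd hs

lemma real_Iic_lineQuantile (α : Measure ℝ) [IsFiniteMeasure α] [NullSingletonClass α] {t : ℝ}
    (h0 : 0 < t) (h1 : t < α.real univ) : α.real (Iic (lineQuantile α t)) = t := by
  refine le_antisymm ?_ ((lineQuantile_le_iff α h0 h1 _).1 le_rfl)
  set g := lineQuantile α t with hg
  have hI : Iio g = ⋃ n : ℕ, Iic (g - 1 / ((n : ℝ) + 1)) := by
    ext x
    simp only [mem_Iio, mem_iUnion, mem_Iic]
    constructor
    · intro hx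
      obtain ⟨n, hn⟩ := exists_nat_one_div_lt (sub_pos.2 hx)
      exact ⟨n, by linarith⟩
    · rintro ⟨n, hn⟩
      have : 0 < 1 / ((n : ℝ) + 1) := by positivity
      linarith
  have ht := tendsto_measure_iUnion_atTop (μ := α)
    (s := fun n : ℕ => Iic (g - 1 / ((n : ℝ) + 1)))
    (fun a b hab => Iic_subset_Iic.2 (by gcongr))
  rw [← hI] at ht
  have ht' := (ENNReal.tendsto_toReal (measure_ne_top α (Iio g))).comp ht
  have heq : α.real (Iic g) = (α (Iio g)).toReal := by
    rw [measureReal_def, measure_congr Iio_ae_eq_Iic]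
  rw [heq]
  refine le_of_tendsto' ht' fun n => ?_
  by_contra! hcon
  have := (lineQuantile_le_iff α h0 h1 (g - 1 / ((n : ℝ) + 1))).2 hcon.le
  have hpos : 0 < 1 / ((n : ℝ) + 1) := by positivity
  linarith

lemma measurable_lineQuantile_kernel {Y : Type*} [MeasurableSpace Y] (κ : Y → Measure ℝ)
    (hfin : ∀ p, IsFiniteMeasure (κ p)) (hκ : Measurable κ) :
    Measurable fun q : Y × ℝ => lineQuantile (κ q.1) q.2 := by
  have hreal : ∀ s, MeasurableSet s → Measurable fun q : Y × ℝ => (κ q.1).real s :=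
    fun s hs => ((Measure.measurable_coe hs).comp (hκ.comp measurable_fst)).ennreal_toReal
  have hR : MeasurableSet {q : Y × ℝ | 0 < q.2 ∧ q.2 < (κ q.1).real univ} :=
    (measurableSet_lt measurable_const measurable_snd).inter
      (measurableSet_lt measurable_snd (hreal _ MeasurableSet.univ))
  refine measurable_of_Iic fun s => ?_
  have : (fun q : Y × ℝ => lineQuantile (κ q.1) q.2) ⁻¹' Iic s =
      ({q : Y × ℝ | 0 < q.2 ∧ q.2 < (κ q.1).real univ} ∩
        {q : Y × ℝ | q.2 ≤ (κ q.1).real (Iic s)}) ∪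
      ({q : Y × ℝ | 0 < q.2 ∧ q.2 < (κ q.1).real univ}ᶜ ∩ {_q : Y × ℝ | 0 ≤ s}) := by
    ext q
    by_cases hq : 0 < q.2 ∧ q.2 < (κ q.1).real univ
    · have := lineQuantile_le_iff (κ q.1) hq.1 hq.2 s
      simp [hq, this]
    · simp only [mem_preimage, mem_Iic, lineQuantile, if_neg hq]
      simp only [mem_union, mem_inter_iff, mem_ofPred_eq, hq, false_and, mem_compl_iff,
        not_false_eq_true, true_and, false_or]
  rw [this]
  exact (hR.inter (measurableSet_le measurable_snd (hreal _ measurableSet_Iic))).union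
    (hR.compl.inter (MeasurableSet.const _))

lemma measurable_lineQuantile (α : Measure ℝ) [IsFiniteMeasure α] :
    Measurable (lineQuantile α) :=
  (measurable_lineQuantile_kernel (Y := Unit) (fun _ => α) (fun _ => inferInstance)
    measurable_const).comp (measurable_const.prodMk measurable_id : Measurable fun t => ((), t))

lemma measurable_real_Iic (α : Measure ℝ) [IsFiniteMeasure α] :
    Measurable fun s => α.real (Iic s) :=
  Monotone.measurable fun _ _ hab => measureReal_mono (Iic_subset_Iic.2 hab)

lemma map_lineQuantile (α : Measure ℝ) [IsFiniteMeasure α] :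
    (volume.restrict (Ioo 0 (α.real univ))).map (lineQuantile α) = α := by
  have : IsFiniteMeasure (volume.restrict (Ioo (0 : ℝ) (α.real univ))) :=
    ⟨by simp⟩
  refine Measure.ext_of_Iic _ _ fun s => ?_
  rw [Measure.map_apply (measurable_lineQuantile α) measurableSet_Iic,
    Measure.restrict_apply (measurable_lineQuantile α measurableSet_Iic)]
  have hF : α.real (Iic s) ≤ α.real univ := measureReal_mono (subset_univ _)
  have h : lineQuantile α ⁻¹' Iic s ∩ Ioo 0 (α.real univ) =
      Ioc 0 (α.real (Iic s)) ∩ Ioo 0 (α.real univ) := by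
    ext t
    simp only [mem_inter_iff, mem_preimage, mem_Iic, mem_Ioo, mem_Ioc]
    constructor
    · rintro ⟨h, h0, h1⟩
      exact ⟨⟨h0, (lineQuantile_le_iff α h0 h1 s).1 h⟩, h0, h1⟩
    · rintro ⟨⟨-, h⟩, h0, h1⟩
      exact ⟨(lineQuantile_le_iff α h0 h1 s).2 h, h0, h1⟩
  rw [h, measure_congr ((ae_eq_refl (Ioc (0 : ℝ) (α.real (Iic s)))).inter Ioo_ae_eq_Ioc),
    inter_eq_left.2 (Ioc_subset_Ioc_right hF), Real.volume_Ioc, sub_zero, measureReal_def,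
    ENNReal.ofReal_toReal (measure_ne_top _ _)]

lemma map_lineQuantile_restrict (α : Measure ℝ) [IsFiniteMeasure α] [NullSingletonClass α] {c : ℝ}
    (hc : c ≤ α.real univ) :
    (volume.restrict (Ioo 0 c)).map (lineQuantile α) = α.restrict {s | α.real (Iic s) < c} := by
  have hm : MeasurableSet {s | α.real (Iic s) < c} :=
    measurableSet_lt (measurable_real_Iic α) measurable_const
  have key : α.restrict {s | α.real (Iic s) < c} =
      ((volume.restrict (Ioo 0 (α.real univ))).map (lineQuantile α)).restrict
        {s | α.real (Iic s) < c} := by rw [map_lineQuantile α]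
  rw [key, Measure.restrict_map (measurable_lineQuantile α) hm,
    Measure.restrict_restrict (measurable_lineQuantile α hm)]
  congr 2
  ext t
  simp only [mem_inter_iff, mem_preimage, mem_ofPred_eq, mem_Ioo]
  constructor
  · rintro ⟨h0, h1⟩
    have h2 := h1.trans_le hc
    exact ⟨by rwa [real_Iic_lineQuantile α h0 h2], h0, h2⟩
  · rintro ⟨h, h0, h2⟩
    rw [real_Iic_lineQuantile α h0 h2] at h
    exact ⟨h0, h⟩

/-- The monotone transport between two measures on the line. -/
def lineTransport (α α' : Measure ℝ) (s : ℝ) : ℝ := lineQuantile α' (α.real (Iic s))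

lemma measurable_lineTransport (α α' : Measure ℝ) [IsFiniteMeasure α] [IsFiniteMeasure α'] :
    Measurable (lineTransport α α') :=
  (measurable_lineQuantile α').comp (measurable_real_Iic α)

lemma map_lineTransport (α α' : Measure ℝ) [IsFiniteMeasure α] [NullSingletonClass α]
    [IsFiniteMeasure α'] [NullSingletonClass α'] {c : ℝ} (hc : c ≤ α.real univ) (hc' : c ≤ α'.real univ) :
    (α.restrict {s | α.real (Iic s) < c}).map (lineTransport α α') =
      α'.restrict {s | α'.real (Iic s) < c} := by
  rw [← map_lineQuantile_restrict α hc, ← map_lineQuantile_restrict α' hc',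
    Measure.map_map (measurable_lineTransport α α') (measurable_lineQuantile α)]
  refine Measure.map_congr ?_
  filter_upwards [ae_restrict_mem measurableSet_Ioo] with t ht
  simp only [Function.comp, lineTransport]
  rw [real_Iic_lineQuantile α ht.1 (ht.2.trans_le hc)]

lemma lineTransport_leftInverse (α α' : Measure ℝ) [IsFiniteMeasure α] [NullSingletonClass α]
    [IsFiniteMeasure α'] [NullSingletonClass α'] {c : ℝ} (hc : c ≤ α.real univ) (hc' : c ≤ α'.real univ) :
    ∀ᵐ s ∂(α.restrict {s | α.real (Iic s) < c}),
      lineTransport α' α (lineTransport α α' s) = s := by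
  have hm : MeasurableSet {s | lineTransport α' α (lineTransport α α' s) = s} :=
    measurableSet_eq_fun ((measurable_lineTransport α' α).comp (measurable_lineTransport α α'))
      measurable_id
  rw [← map_lineQuantile_restrict α hc, ae_map_iff (measurable_lineQuantile α).aemeasurable hm]
  filter_upwards [ae_restrict_mem measurableSet_Ioo] with t ht
  simp only [lineTransport]
  rw [real_Iic_lineQuantile α ht.1 (ht.2.trans_le hc),
    real_Iic_lineQuantile α' ht.1 (ht.2.trans_le hc')]

lemma measure_setOf_real_Iic_ge (α : Measure ℝ) [IsFiniteMeasure α] [NullSingletonClass α] :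
    α {s | ¬ α.real (Iic s) < α.real univ} = 0 := by
  have hm : MeasurableSet {s | α.real (Iic s) < α.real univ} :=
    measurableSet_lt (measurable_real_Iic α) measurable_const
  have h := congrArg (fun μ : Measure ℝ => μ univ)
    ((map_lineQuantile α).symm.trans (map_lineQuantile_restrict α le_rfl))
  simp only [Measure.restrict_apply_univ] at h
  change α {s | α.real (Iic s) < α.real univ}ᶜ = 0
  rw [measure_compl hm (measure_ne_top _ _), ← h, tsub_self]

/-- A jointly measurable, measure preserving and ergodic flow. -/
structure IsErgodicFlow {X M : Type*} [AddCommGroup X] [MeasurableSpace X] [MeasurableSpace M]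
    (σ : X → M → M) (P : Measure M) : Prop where
  measurable : Measurable fun q : X × M => σ q.1 q.2
  zero : ∀ m, σ 0 m = m
  add : ∀ x y m, σ y (σ x m) = σ (x + y) m
  preserving : ∀ x, MeasurePreserving (σ x) P P
  zero_one : ∀ A, MeasurableSet A → (∀ x, σ x ⁻¹' A = A) → P A = 0 ∨ P A = 1

/-- A sequence of measurable functions which separate points and are continuous along orbits. -/
structure SeparatesOrbits {X M : Type*} [TopologicalSpace X] [MeasurableSpace M]
    (σ : X → M → M) (f : ℕ → M → ℝ) : Prop where
  measurable : ∀ j, Measurable (f j)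
  continuous : ∀ j m, Continuous fun x => f j (σ x m)
  separates : ∀ m₁ m₂, (∀ j, f j m₁ = f j m₂) → m₁ = m₂

/-- The points fixed by some translation from `K`. -/
def fixedBySome {X M : Type*} (σ : X → M → M) (K : Set X) : Set M := {m | ∃ x ∈ K, σ x m = m}

/-- The total displacement of the first `J` functions `f j` under the translation by `x`. -/
def displacement {X M : Type*} (σ : X → M → M) (f : ℕ → M → ℝ) (J : ℕ) (x : X) (m : M) : ℝ :=
  ∑ j ∈ Finset.range J, |f j (σ x m) - f j m|

/-- The points displaced by at least `1 / (J + 1)` by every translation from `K`. -/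
def displacedByAll {X M : Type*} (σ : X → M → M) (f : ℕ → M → ℝ) (K : Set X) (J : ℕ) : Set M :=
  {m | ∀ x ∈ K, 1 / ((J : ℝ) + 1) ≤ displacement σ f J x m}

/-- The closed annulus of radii `r` and `3 * r`. -/
def annulus (X : Type*) [Norm X] (r : ℝ) : Set X := {x | r ≤ ‖x‖ ∧ ‖x‖ ≤ 3 * r}

section Flow

variable {X M : Type*} [NormedAddCommGroup X] [NormedSpace ℝ X] [FiniteDimensional ℝ X]
  [MeasurableSpace X] [BorelSpace X] [MeasurableSpace M] {σ : X → M → M} {P : Measure M}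
  {f : ℕ → M → ℝ}

lemma IsErgodicFlow.measurable_apply (hσ : IsErgodicFlow σ P) (x : X) : Measurable (σ x) :=
  hσ.measurable.comp (measurable_const.prodMk measurable_id)

lemma IsErgodicFlow.ae_of_ne_zero [IsProbabilityMeasure P] (hσ : IsErgodicFlow σ P) {A : Set M}
    (hA : MeasurableSet A) (hinv : ∀ x, σ x ⁻¹' A = A) (h0 : P A ≠ 0) : ∀ᵐ m ∂P, m ∈ A := by
  have := (hσ.zero_one A hA hinv).resolve_left h0
  rwa [← prob_compl_eq_zero_iff hA] at this

/-- The stabilizer of a point. -/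
def IsErgodicFlow.stabilizer (hσ : IsErgodicFlow σ P) (m : M) : AddSubgroup X where
  carrier := {x | σ x m = m}
  zero_mem' := hσ.zero m
  add_mem' {x y} hx hy := by
    simp only [mem_ofPred_eq] at *
    rw [← hσ.add, hx, hy]
  neg_mem' {x} hx := by
    simp only [mem_ofPred_eq] at *
    conv_lhs => rw [← hx]
    rw [hσ.add, add_neg_cancel, hσ.zero]

lemma IsErgodicFlow.fixed_apply_iff (hσ : IsErgodicFlow σ P) (x y : X) (m : M) :
    σ x (σ y m) = σ y m ↔ σ x m = m := by
  constructor
  · intro h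
    have := congrArg (σ (-y)) h
    rwa [hσ.add, hσ.add, hσ.add, add_neg_cancel, hσ.zero, show y + (x + -y) = x by abel] at this
  · intro h
    rw [hσ.add, add_comm, ← hσ.add, h]

lemma measurable_displacement (hσ : IsErgodicFlow σ P) (hf : SeparatesOrbits σ f) (J : ℕ)
    (x : X) : Measurable (displacement σ f J x) :=
  Finset.measurable_sum _ fun j _ =>
    (((hf.measurable j).comp (hσ.measurable_apply x)).sub (hf.measurable j)).abs

lemma continuous_displacement (hf : SeparatesOrbits σ f) (J : ℕ) (m : M) :
    Continuous fun x => displacement σ f J x m :=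
  continuous_finsetSum _ fun j _ => ((hf.continuous j m).sub continuous_const).abs

lemma measurableSet_displacedByAll (hσ : IsErgodicFlow σ P) (hf : SeparatesOrbits σ f)
    (K : Set X) (J : ℕ) : MeasurableSet (displacedByAll σ f K J) := by
  obtain ⟨s, hsc, hsd⟩ := TopologicalSpace.exists_countable_dense K
  have : displacedByAll σ f K J =
      ⋂ q ∈ s, {m | 1 / ((J : ℝ) + 1) ≤ displacement σ f J (q : X) m} := by
    ext m
    simp only [displacedByAll, mem_ofPred_eq, mem_iInter]
    refine ⟨fun h q _ => h q q.2, fun h x hx => ?_⟩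
    have hcl : IsClosed {q : K | 1 / ((J : ℝ) + 1) ≤ displacement σ f J (q : X) m} :=
      isClosed_le continuous_const ((continuous_displacement hf J m).comp continuous_subtype_val)
    have := closure_minimal (s := s) (fun q hq => h q hq) hcl
    rw [hsd.closure_eq] at this
    exact this (mem_univ ⟨x, hx⟩)
  rw [this]
  exact MeasurableSet.biInter hsc fun q _ =>
    measurableSet_le measurable_const (measurable_displacement hσ hf J _)

lemma compl_fixedBySome (hf : SeparatesOrbits σ f) {K : Set X} (hK : IsCompact K) :
    (fixedBySome σ K)ᶜ = ⋃ J, displacedByAll σ f K J := by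
  ext m
  simp only [mem_compl_iff, fixedBySome, mem_ofPred_eq, mem_iUnion, displacedByAll]
  constructor
  · intro h
    by_contra! hcon
    choose x hxK hx using hcon
    obtain ⟨a, haK, φ, hφ, hlim⟩ := hK.tendsto_subseq hxK
    refine h ⟨a, haK, hf.separates _ _ fun j => ?_⟩
    have h1 : Tendsto (fun n => |f j (σ (x (φ n)) m) - f j m|) atTop
        (nhds |f j (σ a m) - f j m|) :=
      ((((hf.continuous j m).tendsto a).comp hlim).sub_const _).abs
    have h2 : Tendsto (fun n => |f j (σ (x (φ n)) m) - f j m|) atTop (nhds 0) := by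
      refine squeeze_zero' (Eventually.of_forall fun n => abs_nonneg _) ?_
        (tendsto_one_div_add_atTop_nhds_zero_nat (𝕜 := ℝ))
      filter_upwards [eventually_gt_atTop j] with n hn
      have hle : |f j (σ (x (φ n)) m) - f j m| ≤ displacement σ f (φ n) (x (φ n)) m :=
        Finset.single_le_sum (f := fun j => |f j (σ (x (φ n)) m) - f j m|)
          (fun i _ => abs_nonneg _) (Finset.mem_range.2 (hn.trans_le (hφ.id_le n)))
      refine hle.trans ((hx (φ n)).le.trans ?_)
      have : (n : ℝ) ≤ φ n := by exact_mod_cast hφ.id_le n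
      exact one_div_le_one_div_of_le (by positivity) (by linarith)
    have := tendsto_nhds_unique h1 h2
    linarith [abs_eq_zero.1 this]
  · rintro ⟨J, hJ⟩ ⟨x, hxK, hx⟩
    have h1 := hJ x hxK
    have h2 : displacement σ f J x m = 0 := by simp [displacement, hx]
    have : 0 < 1 / ((J : ℝ) + 1) := by positivity
    linarith

lemma measurableSet_fixedBySome (hσ : IsErgodicFlow σ P) (hf : SeparatesOrbits σ f) {K : Set X}
    (hK : IsCompact K) : MeasurableSet (fixedBySome σ K) := by
  rw [← compl_compl (fixedBySome σ K), compl_fixedBySome hf hK]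
  exact (MeasurableSet.iUnion fun J => measurableSet_displacedByAll hσ hf K J).compl

lemma preimage_fixedBySome (hσ : IsErgodicFlow σ P) (K : Set X) (y : X) :
    σ y ⁻¹' fixedBySome σ K = fixedBySome σ K := by
  ext m
  simp only [fixedBySome, mem_preimage, mem_ofPred_eq, hσ.fixed_apply_iff]

lemma isCompact_annulus (r : ℝ) : IsCompact (annulus X r) := by
  refine (isCompact_closedBall (0 : X) (3 * r)).of_isClosed_subset
    ((isClosed_le continuous_const continuous_norm).inter
      (isClosed_le continuous_norm continuous_const)) fun x hx => ?_
  simpa using hx.2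

/-- If arbitrarily small translations, with direction close to `e`, fix `m`, then so do all
multiples of `e`. -/
lemma fixed_line (hσ : IsErgodicFlow σ P) (hf : SeparatesOrbits σ f) {e : X} {m : M}
    (h : ∀ n : ℕ, ∃ x : X, 0 < ‖x‖ ∧ ‖x‖ ≤ 3 / ((n : ℝ) + 1) ∧
      ‖x - ‖x‖ • e‖ ≤ 1 / ((n : ℝ) + 1) * ‖x‖ ∧ σ x m = m) (t : ℝ) : σ (t • e) m = m := by
  choose x hx0 hx1 hx2 hx3 using h
  set k : ℕ → ℤ := fun n => ⌊t / ‖x n‖⌋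
  have hfix : ∀ n, σ (k n • x n) m = m := fun n =>
    (hσ.stabilizer m).zsmul_mem (hx3 n) (k n)
  have hlim : Tendsto (fun n => k n • x n) atTop (nhds (t • e)) := by
    rw [tendsto_iff_norm_sub_tendsto_zero]
    have hz : Tendsto (fun n : ℕ => ((|t| + 6) * ‖e‖ + |t| + 3 + 3) * (1 / ((n : ℝ) + 1))) atTop
        (nhds 0) := by
      simpa using (tendsto_one_div_add_atTop_nhds_zero_nat (𝕜 := ℝ)).const_mul
        ((|t| + 6) * ‖e‖ + |t| + 3 + 3)
    refine squeeze_zero (fun n => norm_nonneg _) (fun n => ?_) hz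
    have hk1 : (k n : ℝ) * ‖x n‖ ≤ t := by
      have := Int.floor_le (t / ‖x n‖)
      rwa [le_div_iff₀ (hx0 n)] at this
    have hk2 : t < (k n : ℝ) * ‖x n‖ + ‖x n‖ := by
      have := Int.lt_floor_add_one (t / ‖x n‖)
      rw [div_lt_iff₀ (hx0 n)] at this
      linarith
    have hd : |(k n : ℝ) * ‖x n‖ - t| ≤ ‖x n‖ := by
      rw [abs_le]; constructor <;> linarith
    have ha : |(k n : ℝ)| * ‖x n‖ ≤ |t| + ‖x n‖ := by
      rw [← abs_norm (x n), ← abs_mul, abs_norm]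
      have := abs_sub_abs_le_abs_sub ((k n : ℝ) * ‖x n‖) t
      linarith
    have hs : k n • x n - t • e =
        (k n : ℝ) • (x n - ‖x n‖ • e) + ((k n : ℝ) * ‖x n‖ - t) • e := by
      rw [← Int.cast_smul_eq_zsmul ℝ]
      module
    set c := 1 / ((n : ℝ) + 1) with hc
    have hc0 : 0 ≤ c := by positivity
    have hc1 : c ≤ 1 := by
      rw [hc, div_le_one (by positivity)]; linarith [n.cast_nonneg (α := ℝ)]
    have hx1' : ‖x n‖ ≤ 3 * c := by rw [hc]; convert hx1 n using 1; ring
    rw [hs]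
    refine (norm_add_le _ _).trans ?_
    rw [norm_smul, norm_smul, Real.norm_eq_abs, Real.norm_eq_abs]
    have h1 : |(k n : ℝ)| * ‖x n - ‖x n‖ • e‖ ≤ (|t| + 3) * c := by
      calc |(k n : ℝ)| * ‖x n - ‖x n‖ • e‖ ≤ |(k n : ℝ)| * (c * ‖x n‖) := by
            gcongr; exact hx2 n
        _ = |(k n : ℝ)| * ‖x n‖ * c := by ring
        _ ≤ (|t| + 3) * c := by gcongr; linarith
    have h2 : |(k n : ℝ) * ‖x n‖ - t| * ‖e‖ ≤ 3 * c * ‖e‖ := by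
      gcongr; exact hd.trans hx1'
    have h3 : 0 ≤ |t| * ‖e‖ * c := by positivity
    have h4 : 0 ≤ ‖e‖ * c := by positivity
    nlinarith
  refine hf.separates _ _ fun j => ?_
  have h1 := ((hf.continuous j m).tendsto (t • e)).comp hlim
  simp only [Function.comp_def, hfix] at h1
  exact tendsto_nhds_unique h1 tendsto_const_nhds

/-- Either almost surely no translation from a fixed annulus fixes `m`, or almost surely all
translations along a fixed line do. -/
lemma exists_annulus_or_line [IsProbabilityMeasure P] (hσ : IsErgodicFlow σ P)
    (hf : SeparatesOrbits σ f) :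
    (∃ r > 0, P (fixedBySome σ (annulus X r)) = 0) ∨
      ∃ e : X, e ≠ 0 ∧ ∀ᵐ m ∂P, ∀ t : ℝ, σ (t • e) m = m := by
  by_cases h : ∃ r > 0, P (fixedBySome σ (annulus X r)) = 0
  · exact Or.inl h
  right
  push Not at h
  have hall : ∀ᵐ m ∂P, ∀ i : ℕ, m ∈ fixedBySome σ (annulus X (1 / ((i : ℝ) + 1))) :=
    ae_all_iff.2 fun i => hσ.ae_of_ne_zero
      (measurableSet_fixedBySome hσ hf (isCompact_annulus _)) (preimage_fixedBySome hσ _)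
      (h _ (by positivity))
  set sector : X → ℝ → ℕ → Set X := fun e ε i =>
    annulus X (1 / ((i : ℝ) + 1)) ∩ {x | ‖x - ‖x‖ • e‖ ≤ ε * ‖x‖} with hsector
  have hcomp : ∀ e ε i, IsCompact (sector e ε i) := fun e ε i =>
    (isCompact_annulus _).inter_right (isClosed_le (by fun_prop) (by fun_prop))
  set A : X → ℝ → Set M := fun e ε => ⋂ n : ℕ, ⋃ i ≥ n, fixedBySome σ (sector e ε i) with hA
  have hAm : ∀ e ε, MeasurableSet (A e ε) := fun e ε =>
    MeasurableSet.iInter fun n => MeasurableSet.iUnion fun i => MeasurableSet.iUnion fun _ =>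
      measurableSet_fixedBySome hσ hf (hcomp e ε i)
  have hAi : ∀ e ε x, σ x ⁻¹' A e ε = A e ε := fun e ε x => by
    simp only [hA, preimage_iInter, preimage_iUnion, preimage_fixedBySome hσ]
  have hex : ∃ e ∈ Metric.sphere (0 : X) 1, ∀ n : ℕ, P (A e (1 / ((n : ℝ) + 1))) ≠ 0 := by
    by_contra! hcon
    choose! n hn using hcon
    obtain ⟨t, hts, ht⟩ := (isCompact_sphere (0 : X) 1).elim_nhds_subcover
      (fun e => Metric.ball e (1 / ((n e : ℝ) + 1)))
      (fun e _ => Metric.ball_mem_nhds _ (by positivity))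
    have hnot : ∀ᵐ m ∂P, ∀ e ∈ t, m ∉ A e (1 / ((n e : ℝ) + 1)) :=
      (Finset.eventually_all t).2 fun e he => measure_eq_zero_iff_ae_notMem.1 (hn e (hts e he))
    obtain ⟨m, hm1, hm2⟩ := (hall.and hnot).exists
    simp only [hA, mem_iInter, mem_iUnion, not_forall, not_exists] at hm2
    choose! N hN using hm2
    obtain ⟨x, hx, hxm⟩ := hm1 (t.sup N)
    have hpos : 0 < ‖x‖ := lt_of_lt_of_le (by positivity) hx.1
    have hsph : ‖x‖⁻¹ • x ∈ Metric.sphere (0 : X) 1 := by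
      simp [norm_smul, hpos.ne']
    obtain ⟨e, het, hxe⟩ := mem_iUnion₂.1 (ht hsph)
    refine hN e het (t.sup N) (Finset.le_sup het) ⟨x, ⟨hx, ?_⟩, hxm⟩
    rw [mem_ball_iff_norm] at hxe
    have : x - ‖x‖ • e = ‖x‖ • (‖x‖⁻¹ • x - e) := by
      rw [smul_sub, smul_inv_smul₀ hpos.ne']
    simp only [mem_ofPred_eq, this, norm_smul, norm_norm]
    rw [mul_comm]
    gcongr
  obtain ⟨e, hes, he⟩ := hex
  refine ⟨e, ?_, ?_⟩
  · rintro rfl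
    simp at hes
  have hae : ∀ᵐ m ∂P, ∀ n : ℕ, m ∈ A e (1 / ((n : ℝ) + 1)) :=
    ae_all_iff.2 fun n => hσ.ae_of_ne_zero (hAm _ _) (hAi _ _) (he n)
  filter_upwards [hae] with m hm
  refine fixed_line hσ hf fun n => ?_
  obtain ⟨i, hi, x, hx, hxm⟩ := by simpa only [mem_iUnion] using mem_iInter.1 (hm n) n
  refine ⟨x, lt_of_lt_of_le (by positivity) hx.1.1, hx.1.2.trans ?_, hx.2, hxm⟩
  have : (n : ℝ) ≤ i := by exact_mod_cast hi
  rw [mul_one_div]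
  gcongr

lemma exists_clustered [IsProbabilityMeasure P] (hσ : IsErgodicFlow σ P)
    (hf : SeparatesOrbits σ f) {r : ℝ} (h0 : P (fixedBySome σ (annulus X r)) = 0) :
    ∃ U : Set M, MeasurableSet U ∧ P U ≠ 0 ∧ ∀ m ∈ U, ∀ x ∈ annulus X r, σ x m ∉ U := by
  by_contra! hcon
  set U : (J : ℕ) → (Fin J → ℤ) → Set M := fun J k => displacedByAll σ f (annulus X r) J ∩
    {m | ∀ j : Fin J, ⌊f j m * ((J : ℝ) + 1) ^ 2⌋ = k j} with hU
  have hUm : ∀ J k, MeasurableSet (U J k) := fun J k => by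
    refine (measurableSet_displacedByAll hσ hf _ J).inter ?_
    rw [ofPred_forall]
    exact MeasurableSet.iInter fun j =>
      (Int.measurable_floor.comp ((hf.measurable j).mul_const _)) (measurableSet_singleton (k j))
  have hU0 : ∀ J k, P (U J k) = 0 := fun J k => by
    by_contra hne
    obtain ⟨m, hm, x, hx, hxm⟩ := hcon (U J k) (hUm J k) hne
    have h1 := hm.1 x hx
    have h2 : displacement σ f J x m ≤ ∑ j ∈ Finset.range J, 1 / ((J : ℝ) + 1) ^ 2 := by
      refine Finset.sum_le_sum fun j hj => ?_
      have ha := hm.2 ⟨j, Finset.mem_range.1 hj⟩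
      have hb := hxm.2 ⟨j, Finset.mem_range.1 hj⟩
      have hlt := Int.abs_sub_lt_one_of_floor_eq_floor (hb.trans ha.symm)
      simp only at hlt
      rw [← sub_mul, abs_mul, abs_of_pos (by positivity : (0 : ℝ) < ((J : ℝ) + 1) ^ 2)] at hlt
      rw [le_div_iff₀ (by positivity)]
      exact hlt.le
    rw [Finset.sum_const, Finset.card_range, nsmul_eq_mul] at h2
    have h3 : (J : ℝ) * (1 / ((J : ℝ) + 1) ^ 2) < 1 / ((J : ℝ) + 1) := by
      rw [mul_one_div, div_lt_div_iff₀ (by positivity) (by positivity)]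
      nlinarith [J.cast_nonneg (α := ℝ)]
    linarith
  have hcover : (fixedBySome σ (annulus X r))ᶜ ⊆ ⋃ J, ⋃ k, U J k := by
    rw [compl_fixedBySome hf (isCompact_annulus r)]
    refine iUnion_mono fun J m hm => mem_iUnion.2 ⟨fun j => ⌊f j m * ((J : ℝ) + 1) ^ 2⌋, hm, ?_⟩
    exact fun j => rfl
  have h1 : P (fixedBySome σ (annulus X r))ᶜ = 0 :=
    measure_mono_null hcover (measure_iUnion_null fun J => measure_iUnion_null fun k => hU0 J k)
  have := measure_union_le (μ := P) (fixedBySome σ (annulus X r)) (fixedBySome σ (annulus X r))ᶜ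
  rw [union_compl_self, measure_univ, h0, h1] at this
  simp at this

end Flow

/-- An equivariant family of disjoint balls of radius `ρ`: the union of the balls is given by `D`,
and `β` maps a point of `D` to the centre of its ball. -/
structure IsBallFamily {X M : Type*} [NormedAddCommGroup X] [MeasurableSpace X]
    [MeasurableSpace M] (σ : X → M → M) (P : Measure M) (ρ : ℝ) (D : Set (M × X))
    (β : M × X → X) : Prop where
  measurableSet : MeasurableSet D
  measurable : Measurable β
  mem_equiv : ∀ m x y, (σ x m, y) ∈ D ↔ (m, y + x) ∈ D
  centre_equiv : ∀ m x y, β (σ x m, y) = β (m, y + x) - x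
  mem_ball : ∀ m y, (m, y) ∈ D → y ∈ Metric.ball (β (m, y)) ρ
  of_mem_ball : ∀ m y, (m, y) ∈ D → ∀ y' ∈ Metric.ball (β (m, y)) ρ,
    (m, y') ∈ D ∧ β (m, y') = β (m, y)
  pos : 0 < ρ
  nonempty : ∀ᵐ m ∂P, ∃ y, (m, y) ∈ D

section Balls

variable {X M : Type*} [NormedAddCommGroup X] [NormedSpace ℝ X] [FiniteDimensional ℝ X]
  [MeasurableSpace X] [BorelSpace X] [MeasurableSpace M] {σ : X → M → M} {P : Measure M}

local notation "vol" => (Measure.addHaar : Measure X)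

/-- The set of times at which the orbit of `m` visits `U`. -/
def visits (σ : X → M → M) (U : Set M) (m : M) : Set X := {x | σ x m ∈ U}

lemma measurableSet_visits (hσ : IsErgodicFlow σ P) {U : Set M} (hU : MeasurableSet U) (m : M) :
    MeasurableSet (visits σ U m) :=
  (hσ.measurable.comp (measurable_id.prodMk measurable_const)) hU

lemma measurable_measure_visits_inter (hσ : IsErgodicFlow σ P) {U : Set M}
    (hU : MeasurableSet U) {B : Set X} (hB : MeasurableSet B) :
    Measurable fun m => vol (visits σ U m ∩ B) := by
  have hs : MeasurableSet {q : M × X | σ q.2 q.1 ∈ U ∧ q.2 ∈ B} :=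
    ((hσ.measurable.comp measurable_swap) hU).inter (measurable_snd hB)
  exact measurable_measure_prodMk_left hs

lemma measurable_integral_visits_inter (hσ : IsErgodicFlow σ P) {U : Set M}
    (hU : MeasurableSet U) {B : Set X} (hB : MeasurableSet B) :
    Measurable fun m => ∫ x in visits σ U m ∩ B, x ∂vol := by
  have hs : MeasurableSet {q : M × X | σ q.2 q.1 ∈ U ∧ q.2 ∈ B} :=
    ((hσ.measurable.comp measurable_swap) hU).inter (measurable_snd hB)
  have h : StronglyMeasurable fun q : M × X =>
      {q : M × X | σ q.2 q.1 ∈ U ∧ q.2 ∈ B}.indicator (fun q => q.2) q :=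
    (measurable_snd.indicator hs).stronglyMeasurable
  have h2 := (h.integral_prod_right' (ν := vol)).measurable
  convert h2 using 2 with m
  rw [← integral_indicator ((measurableSet_visits hσ hU m).inter hB)]
  rfl

lemma visits_apply (hσ : IsErgodicFlow σ P) (U : Set M) (m : M) (y : X) :
    visits σ U (σ y m) = (fun x => x + y) ⁻¹' visits σ U m := by
  ext x
  simp [visits, hσ.add, add_comm]

lemma ae_measure_visits_ne_zero [IsProbabilityMeasure P] (hσ : IsErgodicFlow σ P) {U : Set M}
    (hU : MeasurableSet U) (hP : P U ≠ 0) : ∀ᵐ m ∂P, vol (visits σ U m) ≠ 0 := by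
  have hm : Measurable fun m => vol (visits σ U m) := by
    simpa using measurable_measure_visits_inter hσ hU MeasurableSet.univ
  refine hσ.ae_of_ne_zero (A := {m | vol (visits σ U m) ≠ 0})
    (hm (measurableSet_singleton 0)).compl (fun x => ?_) fun h0 => ?_
  · ext m
    simp only [mem_preimage, mem_ofPred_eq, visits_apply hσ, measure_preimage_add_right]
  · have h1 : ∀ᵐ m ∂P, vol (visits σ U m) = 0 := by
      have := measure_eq_zero_iff_ae_notMem.1 h0
      filter_upwards [this] with m hm
      simpa using hm
    have hs : MeasurableSet {q : X × M | σ q.1 q.2 ∈ U} := hσ.measurable hU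
    have h2 : (Measure.prod vol P) {q : X × M | σ q.1 q.2 ∈ U} = 0 := by
      rw [Measure.prod_apply_symm hs]
      exact lintegral_eq_zero_of_ae_eq_zero h1
    rw [Measure.measure_prod_null hs] at h2
    obtain ⟨x, hx⟩ := h2.exists
    refine hP ?_
    rw [← (hσ.preserving x).measure_preimage hU.nullMeasurableSet]
    exact hx

/-- The mean position of the visits to `U` at times of norm at most `R`. -/
def meanVisit (σ : X → M → M) (U : Set M) (R : ℝ) (m : M) : X :=
  ⨍ x in visits σ U m ∩ Metric.closedBall 0 R, x ∂vol

lemma measurable_meanVisit (hσ : IsErgodicFlow σ P) {U : Set M} (hU : MeasurableSet U) (R : ℝ) :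
    Measurable (meanVisit σ U R) := by
  have h : meanVisit σ U R = fun m => (vol (visits σ U m ∩ Metric.closedBall 0 R)).toReal⁻¹ •
      ∫ x in visits σ U m ∩ Metric.closedBall 0 R, x ∂vol := by
    funext m
    rw [meanVisit, setAverage_eq]; rfl
  rw [h]
  exact ((measurable_measure_visits_inter hσ hU
    Metric.isClosed_closedBall.measurableSet).ennreal_toReal.inv).smul
    (measurable_integral_visits_inter hσ hU Metric.isClosed_closedBall.measurableSet)

/-- The origin is the mean position of an isolated cluster of visits to `U`. -/
def clusterCentre (σ : X → M → M) (U : Set M) (r : ℝ) : Set M :=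
  {m | vol (visits σ U m ∩ Metric.closedBall 0 r) ≠ 0 ∧
    vol (visits σ U m ∩ (Metric.closedBall 0 (2 * r) \ Metric.closedBall 0 r)) = 0 ∧
    ∫ x in visits σ U m ∩ Metric.closedBall 0 r, x ∂vol = 0}

lemma measurableSet_clusterCentre (hσ : IsErgodicFlow σ P) {U : Set M} (hU : MeasurableSet U)
    (r : ℝ) : MeasurableSet (clusterCentre σ U r) := by
  have hB : ∀ s : ℝ, MeasurableSet (Metric.closedBall (0 : X) s) := fun s =>
    Metric.isClosed_closedBall.measurableSet
  exact ((measurable_measure_visits_inter hσ hU (hB r)) (measurableSet_singleton 0)).compl.inter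
    (((measurable_measure_visits_inter hσ hU ((hB _).diff (hB _))) (measurableSet_singleton 0)).inter
      ((measurable_integral_visits_inter hσ hU (hB r)) (measurableSet_singleton 0)))

lemma integrableOn_id_inter_closedBall (S : Set X) (y : X) (R : ℝ) :
    IntegrableOn (fun x : X => x) (S ∩ Metric.closedBall y R) vol :=
  (continuous_id.continuousOn.integrableOn_compact (isCompact_closedBall y R)).mono_set
    inter_subset_right

lemma measure_inter_closedBall_ne_top (S : Set X) (y : X) (R : ℝ) :
    vol (S ∩ Metric.closedBall y R) ≠ ⊤ :=
  ((measure_mono inter_subset_right).trans_lt (isCompact_closedBall y R).measure_lt_top).ne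

lemma setIntegral_add_const {S : Set X} (hS : vol S ≠ ⊤)
    (hi : IntegrableOn (fun x : X => x) S vol) (c : X) :
    ∫ x in S, (x + c) ∂vol = ∫ x in S, x ∂vol + (vol S).toReal • c := by
  rw [integral_add hi (integrableOn_const hS), setIntegral_const]
  rfl

lemma setIntegral_preimage_add_right (S : Set X) (g : X → X) (y : X) :
    ∫ x in (fun x => x + y) ⁻¹' S, g (x + y) ∂vol = ∫ x in S, g x ∂vol :=
  (measurePreserving_add_right vol y).setIntegral_preimage_emb
    (measurableEmbedding_addRight y) g S

/-- From any nearby position, the mean of the visits recovers the centre of the cluster. -/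
lemma meanVisit_eq (hσ : IsErgodicFlow σ P) {U : Set M} (hU : MeasurableSet U) {r : ℝ}
    {m : M} (hm : m ∈ clusterCentre σ U r) {c : X} (hc : ‖c‖ ≤ r / 2) :
    meanVisit σ U (3 * r / 2) (σ (-c) m) = c := by
  obtain ⟨h0, h1, h2⟩ := hm
  set V := visits σ U m
  have hVm : MeasurableSet V := measurableSet_visits hσ hU m
  set S := V ∩ Metric.closedBall (-c) (3 * r / 2) with hS
  have hpre : visits σ U (σ (-c) m) ∩ Metric.closedBall 0 (3 * r / 2) =
      (fun x => x + -c) ⁻¹' S := by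
    rw [visits_apply hσ]
    ext x
    simp [hS, V]
  have hae : S =ᵐ[vol] (V ∩ Metric.closedBall 0 r : Set X) := by
    have hsub : V ∩ Metric.closedBall 0 r ⊆ S := by
      rintro x ⟨hxV, hx⟩
      refine ⟨hxV, ?_⟩
      rw [mem_closedBall_iff_norm] at *
      rw [sub_zero] at hx
      rw [sub_neg_eq_add]
      linarith [norm_add_le x c]
    refine (ae_eq_set.2 ⟨measure_mono_null ?_ h1, by rw [sdiff_eq_empty.2 hsub, measure_empty]⟩)
    rintro x ⟨⟨hxV, hx⟩, hx2⟩
    refine ⟨hxV, ?_, fun h => hx2 ⟨hxV, h⟩⟩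
    rw [mem_closedBall_iff_norm] at *
    rw [sub_neg_eq_add] at hx
    rw [sub_zero]
    have := norm_sub_le (x + c) c
    rw [add_sub_cancel_right] at this
    linarith
  have hvol : vol S = vol (V ∩ Metric.closedBall 0 r) := measure_congr hae
  have hint : ∫ x in S, x ∂vol = 0 := by rw [setIntegral_congr_set hae, h2]
  have htop : vol S ≠ ⊤ := measure_inter_closedBall_ne_top _ _ _
  have hreal : (vol S).toReal ≠ 0 := by
    rw [ENNReal.toReal_ne_zero]
    exact ⟨by rwa [hvol], htop⟩
  have hI : ∫ x in (fun x => x + -c) ⁻¹' S, x ∂vol = (vol S).toReal • c := by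
    have := setIntegral_preimage_add_right S (fun x => x + c) (-c)
    simp only [neg_add_cancel_right] at this
    rw [this, setIntegral_add_const htop (integrableOn_id_inter_closedBall _ _ _), hint, zero_add]
  rw [meanVisit, hpre, setAverage_eq, hI, measureReal_def, measure_preimage_add_right,
    inv_smul_smul₀ hreal]

lemma exists_clusterCentre (hσ : IsErgodicFlow σ P) {U : Set M} (hU : MeasurableSet U) {r : ℝ}
    (hr : 0 < r) (hUr : ∀ m ∈ U, ∀ x ∈ annulus X r, σ x m ∉ U) {m : M}
    (hm : vol (visits σ U m) ≠ 0) : ∃ b, σ b m ∈ clusterCentre σ U r := by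
  set V := visits σ U m with hV
  have hVm : MeasurableSet V := measurableSet_visits hσ hU m
  have hgap : ∀ x ∈ V, ∀ x' ∈ V, dist x x' ≤ 3 * r → dist x x' < r := by
    intro x hx x' hx' hd
    by_contra! hlt
    refine hUr (σ x' m) hx' (x - x') ⟨by rwa [← dist_eq_norm], by rwa [← dist_eq_norm]⟩ ?_
    rw [hσ.add, add_sub_cancel]
    exact hx
  obtain ⟨y, hyV, hy⟩ := exists_mem_forall_mem_nhdsWithin_pos_measure hm
  set C := V ∩ Metric.closedBall y r with hC
  have hC0 : vol C ≠ 0 := (hy _ (inter_mem_nhdsWithin V (Metric.closedBall_mem_nhds y hr))).ne'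
  have hCtop : vol C ≠ ⊤ := measure_inter_closedBall_ne_top _ _ _
  have hCi : IntegrableOn (fun x : X => x) C vol := integrableOn_id_inter_closedBall _ _ _
  have hCm : MeasurableSet C := hVm.inter Metric.isClosed_closedBall.measurableSet
  set b : X := ⨍ x in C, x ∂vol with hb
  have hmean : ∀ x, (∀ x' ∈ C, x' ∈ Metric.closedBall x r) → b ∈ Metric.closedBall x r :=
    fun x hx => (convex_closedBall x r).set_average_mem Metric.isClosed_closedBall hC0 hCtop
      ((ae_restrict_iff' hCm).2 (Eventually.of_forall fun x' hx' => hx x' hx')) hCi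
  have hby : dist b y ≤ r := hmean y fun x' hx' => hx'.2
  have hCb : C ⊆ Metric.closedBall b r := by
    intro x hx
    rw [Metric.mem_closedBall, dist_comm]
    refine hmean x fun x' hx' => (hgap x' hx'.1 x hx.1 ?_).le
    have h1 := Metric.mem_closedBall.1 hx.2
    have h2 := Metric.mem_closedBall.1 hx'.2
    linarith [dist_triangle_right x' x y]
  have hbC : V ∩ Metric.closedBall b (2 * r) ⊆ C := by
    rintro x ⟨hxV, hx⟩
    refine ⟨hxV, (hgap x hxV y hyV ?_).le⟩
    rw [Metric.mem_closedBall] at hx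
    linarith [dist_triangle x b y]
  have hball : V ∩ Metric.closedBall b r = C := Subset.antisymm
    (fun x hx => hbC ⟨hx.1, Metric.closedBall_subset_closedBall (by linarith) hx.2⟩)
    fun x hx => ⟨hx.1, hCb hx⟩
  have hpre : ∀ s : ℝ, visits σ U (σ b m) ∩ Metric.closedBall 0 s =
      (fun x => x + b) ⁻¹' (V ∩ Metric.closedBall b s) := by
    intro s
    rw [visits_apply hσ]
    ext x
    simp [hV]
  refine ⟨b, ?_, ?_, ?_⟩
  · rw [hpre, hball, measure_preimage_add_right]
    exact hC0
  · rw [inter_sdiff_distrib_left, hpre, hpre, ← preimage_sdiff, hball, sdiff_eq_empty.2 hbC,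
      preimage_empty, measure_empty]
  · rw [hpre, hball]
    have := setIntegral_preimage_add_right C (fun x => x + -b) b
    simp only [add_neg_cancel_right] at this
    rw [this, setIntegral_add_const hCtop hCi, hb, setAverage_eq, smul_neg, measureReal_def,
      smul_inv_smul₀ (ENNReal.toReal_ne_zero.2 ⟨hC0, hCtop⟩), add_neg_cancel]

lemma exists_ballFamily [IsProbabilityMeasure P] (hσ : IsErgodicFlow σ P) {U : Set M}
    (hU : MeasurableSet U) (hP : P U ≠ 0) {r : ℝ} (hr : 0 < r)
    (hUr : ∀ m ∈ U, ∀ x ∈ annulus X r, σ x m ∉ U) :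
    ∃ D β, IsBallFamily σ P (r / 2) D β := by
  set β : M × X → X := fun q => q.2 + meanVisit σ U (3 * r / 2) (σ q.2 q.1) with hβ
  have hβm : Measurable β := measurable_snd.add
    ((measurable_meanVisit hσ hU _).comp (hσ.measurable.comp measurable_swap))
  have hβeq : ∀ m b y, σ b m ∈ clusterCentre σ U r → ‖b - y‖ ≤ r / 2 → β (m, y) = b := by
    intro m b y hb hy
    have := meanVisit_eq hσ hU hb hy
    rw [hσ.add, show b + -(b - y) = y by abel] at this
    simp only [hβ, this]
    abel
  have hβequiv : ∀ m x y, β (σ x m, y) = β (m, y + x) - x := by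
    intro m x y
    simp only [hβ, hσ.add, add_comm x y]
    abel
  refine ⟨{q | σ (β q) q.1 ∈ clusterCentre σ U r ∧ q.2 ∈ Metric.ball (β q) (r / 2)}, β, ?_, hβm,
    ?_, hβequiv, fun m y h => h.2, ?_, by positivity, ?_⟩
  · refine MeasurableSet.inter ((hσ.measurable.comp (hβm.prodMk measurable_fst))
      (measurableSet_clusterCentre hσ hU r)) ?_
    exact measurableSet_lt (measurable_snd.dist hβm) measurable_const
  · intro m x y
    simp only [mem_ofPred_eq, hβequiv, hσ.add, add_sub_cancel, Metric.mem_ball]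
    rw [← dist_add_right y _ x, sub_add_cancel]
  · rintro m y ⟨h1, h2⟩ y' hy'
    have h3 : β (m, y') = β (m, y) := by
      refine hβeq m _ y' h1 ?_
      rw [← dist_eq_norm, dist_comm]
      exact (Metric.mem_ball.1 hy').le
    exact ⟨⟨by rw [h3]; exact h1, by rw [h3]; exact hy'⟩, h3⟩
  · filter_upwards [ae_measure_visits_ne_zero hσ hU hP] with m hm
    obtain ⟨b, hb⟩ := exists_clusterCentre hσ hU hr hUr hm
    have h3 : β (m, b) = b := hβeq m b b hb (by simpa using by positivity)
    refine ⟨b, ?_⟩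
    show σ (β (m, b)) m ∈ clusterCentre σ U r ∧ b ∈ Metric.ball (β (m, b)) (r / 2)
    rw [h3]
    exact ⟨hb, Metric.mem_ball_self (by positivity)⟩

end Balls

/-- A locally finite kernel which is equivariant under a flow. -/
structure IsEquivariantKernel {X M : Type*} [NormedAddCommGroup X] [MeasurableSpace X]
    [MeasurableSpace M] (σ : X → M → M) (ζ : ProbabilityTheory.Kernel M X) : Prop where
  ball_lt_top : ∀ m (r : ℝ), ζ m (Metric.ball 0 r) < ⊤
  apply_flow : ∀ x m, ζ (σ x m) = (ζ m).map (fun y => y - x)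

section Kernels

open ProbabilityTheory

variable {X M : Type*} [NormedAddCommGroup X] [NormedSpace ℝ X] [FiniteDimensional ℝ X]
  [MeasurableSpace X] [BorelSpace X] [MeasurableSpace M] {σ : X → M → M} {P : Measure M}

lemma isSFiniteKernel_of_ball_lt_top (ζ : Kernel M X)
    (h : ∀ m (r : ℝ), ζ m (Metric.ball 0 r) < ⊤) : IsSFiniteKernel ζ := by
  classical
  set R : ℕ → Set X := disjointed fun n : ℕ => Metric.ball (0 : X) n with hR
  have hRm : ∀ n, MeasurableSet (R n) := fun n =>
    MeasurableSet.disjointed (fun n => Metric.isOpen_ball.measurableSet) n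
  have hRu : ⋃ n, R n = univ := by
    rw [hR, iUnion_disjointed]
    exact Metric.iUnion_ball_nat 0
  have hRfin : ∀ m n, ζ m (R n) < ⊤ := fun m n =>
    (measure_mono (disjointed_subset _ n)).trans_lt (h m n)
  set S : ℕ → ℕ → Set M := fun n j => {m | ⌊(ζ m (R n)).toReal⌋₊ = j} with hS
  have hSm : ∀ n j, MeasurableSet (S n j) := fun n j =>
    measurableSet_eq_fun (Nat.measurable_floor.comp (ζ.measurable_coe (hRm n)).ennreal_toReal)
      measurable_const
  have hfin : ∀ q : ℕ × ℕ, IsFiniteKernel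
      (Kernel.piecewise (hSm q.1 q.2) (ζ.restrict (hRm q.1)) 0) := by
    intro q
    refine ⟨⟨ENNReal.ofReal (q.2 + 1), ENNReal.ofReal_lt_top, fun m => ?_⟩⟩
    rw [Kernel.piecewise_apply]
    split_ifs with hm
    · rw [Kernel.restrict_apply, Measure.restrict_apply_univ,
        ← ENNReal.ofReal_toReal (hRfin m q.1).ne]
      refine ENNReal.ofReal_le_ofReal ?_
      have h1 := Nat.lt_floor_add_one (ζ m (R q.1)).toReal
      have h2 : ⌊(ζ m (R q.1)).toReal⌋₊ = q.2 := hm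
      rw [h2] at h1
      exact h1.le
    · simp
  have hsum : ζ = Kernel.sum fun q : ℕ × ℕ =>
      Kernel.piecewise (hSm q.1 q.2) (ζ.restrict (hRm q.1)) 0 := by
    ext m s hs
    rw [Kernel.sum_apply, Measure.sum_apply _ hs, ENNReal.tsum_prod (f := fun n j =>
      (Kernel.piecewise (hSm n j) (ζ.restrict (hRm n)) 0) m s)]
    have : ∀ n, ∑' j, (Kernel.piecewise (hSm n j) (ζ.restrict (hRm n)) 0) m s =
        (ζ m).restrict (R n) s := by
      intro n
      rw [tsum_eq_single ⌊(ζ m (R n)).toReal⌋₊]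
      · rw [Kernel.piecewise_apply, if_pos (show m ∈ S n _ from rfl), Kernel.restrict_apply]
      · intro j hj
        rw [Kernel.piecewise_apply, if_neg (show m ∉ S n j from fun hm => hj (Eq.symm hm))]
        simp
    simp only [this]
    rw [← Measure.sum_apply _ hs, ← Measure.restrict_iUnion (disjoint_disjointed _) hRm, hRu,
      Measure.restrict_univ]
  rw [hsum]
  exact Kernel.isSFiniteKernel_sum

lemma IsEquivariantKernel.isSFiniteKernel {ζ : Kernel M X} (hζ : IsEquivariantKernel σ ζ) :
    IsSFiniteKernel ζ :=
  isSFiniteKernel_of_ball_lt_top ζ hζ.ball_lt_top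

/-- The restriction of a kernel to a measurable subset of the product. -/
def fibreRestrict (ζ : Kernel M X) [IsSFiniteKernel ζ] {C : Set (M × X)} (hC : MeasurableSet C) :
    Kernel M X where
  toFun m := (ζ m).restrict (Prod.mk m ⁻¹' C)
  measurable' := by
    refine Measure.measurable_of_measurable_coe _ fun s hs => ?_
    simp only [Measure.restrict_apply hs]
    exact Kernel.measurable_kernel_prodMk_left ((measurable_snd hs).inter hC)

lemma fibreRestrict_apply (ζ : Kernel M X) [IsSFiniteKernel ζ] {C : Set (M × X)}
    (hC : MeasurableSet C) (m : M) : fibreRestrict ζ hC m = (ζ m).restrict (Prod.mk m ⁻¹' C) :=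
  rfl

lemma IsEquivariantKernel.fibreRestrict {ζ : Kernel M X} [IsSFiniteKernel ζ]
    (hζ : IsEquivariantKernel σ ζ) {C : Set (M × X)} (hC : MeasurableSet C)
    (hCσ : ∀ m x y, (σ x m, y) ∈ C ↔ (m, y + x) ∈ C) :
    IsEquivariantKernel σ (fibreRestrict ζ hC) where
  ball_lt_top m r := (Measure.restrict_apply_le _ _).trans_lt (hζ.ball_lt_top m r)
  apply_flow x m := by
    rw [fibreRestrict_apply, fibreRestrict_apply, hζ.apply_flow,
      Measure.restrict_map (measurable_sub_const x) (measurable_prodMk_left hC)]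
    congr 2
    ext y
    simp [hCσ]

lemma lintegral_flow [SFinite P] (hσ : IsErgodicFlow σ P) {ζ : Kernel M X} [IsSFiniteKernel ζ]
    (hζ : IsEquivariantKernel σ ζ) (t : X) {G : M × X → ENNReal} (hG : Measurable G) :
    ∫⁻ m, ∫⁻ x, G (σ t m, x - t) ∂(ζ m) ∂P = ∫⁻ m, ∫⁻ x, G (m, x) ∂(ζ m) ∂P := by
  have h : ∀ m, ∫⁻ x, G (σ t m, x - t) ∂(ζ m) = ∫⁻ x, G (σ t m, x) ∂(ζ (σ t m)) := by
    intro m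
    rw [hζ.apply_flow, lintegral_map (f := fun x => G (σ t m, x))
      (hG.comp measurable_prodMk_left) (measurable_sub_const t)]
  simp only [h]
  exact (hσ.preserving t).lintegral_comp (f := fun m => ∫⁻ x, G (m, x) ∂(ζ m))
    hG.lintegral_kernel_prod_right'

/-- The mass transport principle for an equivariant map. -/
lemma lintegral_preimage_ball_eq [SFinite P] (hσ : IsErgodicFlow σ P) {ζ : Kernel M X}
    (hζ : IsEquivariantKernel σ ζ) {T : M × X → X} (hT : Measurable T)
    (hTσ : ∀ m x y, T (σ x m, y) = T (m, y + x) - x) {r : ℝ} (hr : 0 < r) :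
    ∫⁻ m, (ζ m).map (fun x => T (m, x)) (Metric.ball 0 r) ∂P =
      ∫⁻ m, ζ m (Metric.ball 0 r) ∂P := by
  have := hζ.isSFiniteKernel
  set B : Set X := Metric.ball 0 r with hB
  have hBm : MeasurableSet B := Metric.isOpen_ball.measurableSet
  set i : X → ENNReal := B.indicator 1 with hi
  have him : Measurable i := measurable_one.indicator hBm
  have hint : ∀ μ : Measure X, ∫⁻ x, i x ∂μ = μ B := fun μ => lintegral_indicator_one hBm
  set vol : Measure X := Measure.addHaar
  have hvol : ∀ x, ∫⁻ t, i (x - t) ∂vol = vol B := fun x => by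
    rw [lintegral_sub_left_eq_self (fun t => i t) x, hint]
  have hvol' : ∀ x, ∫⁻ t, i (x + t) ∂vol = vol B := fun x => by
    rw [lintegral_add_left_eq_self (fun t => i t) x, hint]
  have hm1 : Measurable fun q : X × (M × X) => i q.2.2 * i (T q.2 - q.1) := by fun_prop
  have hm2 : Measurable fun q : X × (M × X) => i (q.2.2 + q.1) * i (T q.2) := by fun_prop
  have e1 : ∀ t, ∫⁻ q, i q.2 * i (T q - t) ∂(P.compProd ζ) =
      ∫⁻ q, i (q.2 + t) * i (T q) ∂(P.compProd ζ) := by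
    intro t
    have hm1t : Measurable fun q : M × X => i q.2 * i (T q - t) := by fun_prop
    have hm2t : Measurable fun q : M × X => i (q.2 + t) * i (T q) := by fun_prop
    rw [Measure.lintegral_compProd hm1t, Measure.lintegral_compProd hm2t,
      ← lintegral_flow hσ hζ t hm2t]
    simp [hTσ]
  have e2 : vol B * ∫⁻ m, ζ m B ∂P =
      ∫⁻ t, ∫⁻ q, i q.2 * i (T q - t) ∂(P.compProd ζ) ∂vol := by
    rw [lintegral_lintegral_swap hm1.aemeasurable]
    have hm : Measurable fun q : M × X => i q.2 := by fun_prop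
    simp_rw [fun q : M × X => lintegral_const_mul (i q.2) (μ := vol)
      (f := fun t => i (T q - t)) (by fun_prop), hvol]
    rw [lintegral_mul_const _ hm, Measure.lintegral_compProd hm, mul_comm]
    simp only [hint]
  have e3 : vol B * ∫⁻ m, (ζ m).map (fun x => T (m, x)) B ∂P =
      ∫⁻ t, ∫⁻ q, i (q.2 + t) * i (T q) ∂(P.compProd ζ) ∂vol := by
    rw [lintegral_lintegral_swap hm2.aemeasurable]
    have hm : Measurable fun q : M × X => i (T q) := by fun_prop
    simp_rw [fun q : M × X => lintegral_mul_const (i (T q)) (μ := vol)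
      (f := fun t => i (q.2 + t)) (by fun_prop), hvol']
    rw [lintegral_const_mul _ hm, Measure.lintegral_compProd hm]
    congr 2
    ext m
    rw [← hint, lintegral_map (g := fun x => T (m, x)) him (hT.comp measurable_prodMk_left)]
  rw [lintegral_congr e1, ← e3] at e2
  exact ((ENNReal.mul_right_inj (Metric.measure_ball_pos vol 0 hr).ne'
    measure_ball_lt_top.ne).1 e2).symm

lemma ae_eq_zero_of_forall_ball (ζ : Kernel M X)
    (h : ∀ n : ℕ, ∫⁻ m, ζ m (Metric.ball 0 (n + 1)) ∂P = 0) : ∀ᵐ m ∂P, ζ m = 0 := by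
  have : ∀ᵐ m ∂P, ∀ n : ℕ, ζ m (Metric.ball 0 (n + 1)) = 0 := by
    rw [ae_all_iff]
    intro n
    exact (lintegral_eq_zero_iff (ζ.measurable_coe Metric.isOpen_ball.measurableSet)).1 (h n)
  filter_upwards [this] with m hm
  rw [← Measure.measure_univ_eq_zero, ← Metric.iUnion_ball_nat_succ (0 : X)]
  exact measure_iUnion_null hm

/-- If two equivariant kernels have the same mean masses and almost surely one of them vanishes,
then both of them vanish almost surely. -/
lemma ae_eq_zero_of_or [IsProbabilityMeasure P] (hσ : IsErgodicFlow σ P) {ζ ζ' : Kernel M X}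
    (hζ : IsEquivariantKernel σ ζ)
    (hint : ∀ n : ℕ, ∫⁻ m, ζ m (Metric.ball 0 (n + 1)) ∂P =
      ∫⁻ m, ζ' m (Metric.ball 0 (n + 1)) ∂P)
    (h : ∀ᵐ m ∂P, ζ m = 0 ∨ ζ' m = 0) : (∀ᵐ m ∂P, ζ m = 0) ∧ ∀ᵐ m ∂P, ζ' m = 0 := by
  have hA : MeasurableSet {m | ζ m univ = 0} :=
    ζ.measurable_coe MeasurableSet.univ (measurableSet_singleton 0)
  have hinv : ∀ x, σ x ⁻¹' {m | ζ m univ = 0} = {m | ζ m univ = 0} := by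
    intro x
    ext m
    have : ζ (σ x m) univ = ζ m univ := by
      rw [hζ.apply_flow, Measure.map_apply (measurable_sub_const x) MeasurableSet.univ]
      rfl
    simp only [mem_preimage]
    show ζ (σ x m) univ = 0 ↔ ζ m univ = 0
    rw [this]
  by_cases h0 : P {m | ζ m univ = 0} = 0
  · have h1 : ∀ᵐ m ∂P, ζ' m = 0 := by
      have : ∀ᵐ m ∂P, m ∉ {m | ζ m univ = 0} := measure_eq_zero_iff_ae_notMem.1 h0
      filter_upwards [this, h] with m hm hm'
      rcases hm' with hm' | hm'
      · exact absurd (by simp [hm']) hm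
      · exact hm'
    refine ⟨ae_eq_zero_of_forall_ball ζ fun n => ?_, h1⟩
    rw [hint n]
    refine lintegral_eq_zero_of_ae_eq_zero ?_
    filter_upwards [h1] with m hm
    simp [hm]
  · have h1 : ∀ᵐ m ∂P, ζ m = 0 := by
      filter_upwards [hσ.ae_of_ne_zero hA hinv h0] with m hm
      exact Measure.measure_univ_eq_zero.1 hm
    refine ⟨h1, ae_eq_zero_of_forall_ball ζ' fun n => ?_⟩
    rw [← hint n]
    refine lintegral_eq_zero_of_ae_eq_zero ?_
    filter_upwards [h1] with m hm
    simp [hm]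

end Kernels

section Cells

variable {X : Type*} [NormedAddCommGroup X] [NormedSpace ℝ X] [FiniteDimensional ℝ X]
  [MeasurableSpace X] [BorelSpace X]

/-- The part of `μ` on the intersection of `A` with the ball of radius `ρ` around `b + z`,
transported to the real line. -/
def cellMeasure (ψ : X ≃ᵐ ℝ) (ρ : ℝ) (z : X) (μ : Measure X) (A : Set X) (b : X) : Measure ℝ :=
  (μ.restrict (A ∩ Metric.ball (b + z) ρ)).map fun y => ψ (y - b)

/-- The part of `A` in the ball around `b + z` which is matched to a part of `A'` in the ball
around `b + z'`. -/
def cellMatched (ψ : X ≃ᵐ ℝ) (ρ : ℝ) (z z' : X) (μ ν : Measure X) (A A' : Set X) (b : X) : Set X :=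
  (A ∩ Metric.ball (b + z) ρ) ∩ {y | (cellMeasure ψ ρ z μ A b).real (Iic (ψ (y - b))) <
    min ((cellMeasure ψ ρ z μ A b).real univ) ((cellMeasure ψ ρ z' ν A' b).real univ)}

/-- The monotone matching between two cells. -/
def cellMap (ψ : X ≃ᵐ ℝ) (ρ : ℝ) (z z' : X) (μ ν : Measure X) (A A' : Set X) (b y : X) : X :=
  b + ψ.symm (lineTransport (cellMeasure ψ ρ z μ A b) (cellMeasure ψ ρ z' ν A' b) (ψ (y - b)))

variable (ψ : X ≃ᵐ ℝ) (ρ : ℝ) (z z' : X) {μ ν : Measure X} {A A' : Set X} (b : X)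

/-- The coordinate change from `X` to the real line, centred at `b`. -/
def cellCoord : X ≃ᵐ ℝ := (MeasurableEquiv.subRight b).trans ψ

lemma cellCoord_apply (y : X) : cellCoord ψ b y = ψ (y - b) := rfl

lemma cellCoord_symm_apply (s : ℝ) : (cellCoord ψ b).symm s = b + ψ.symm s := by
  apply (cellCoord ψ b).injective
  simp [cellCoord_apply]

lemma measure_inter_ball_lt_top (hμ : ∀ r : ℝ, μ (Metric.ball 0 r) < ⊤) (A : Set X) (x : X) :
    μ (A ∩ Metric.ball x ρ) < ⊤ := by
  refine (measure_mono ?_).trans_lt (hμ (ρ + ‖x‖))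
  exact inter_subset_right.trans (Metric.ball_subset_ball' (by simp))

lemma isFiniteMeasure_cellMeasure (hμ : ∀ r : ℝ, μ (Metric.ball 0 r) < ⊤) (A : Set X) :
    IsFiniteMeasure (cellMeasure ψ ρ z μ A b) := by
  have : IsFiniteMeasure (μ.restrict (A ∩ Metric.ball (b + z) ρ)) :=
    isFiniteMeasure_restrict.2 (measure_inter_ball_lt_top ρ hμ A _).ne
  exact Measure.isFiniteMeasure_map _ _

lemma nullSingletonClass_cellMeasure [NullSingletonClass μ] (A : Set X) :
    NullSingletonClass (cellMeasure ψ ρ z μ A b) := by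
  refine ⟨fun s => ?_⟩
  have h : cellMeasure ψ ρ z μ A b = (μ.restrict (A ∩ Metric.ball (b + z) ρ)).map
    (cellCoord ψ b) := rfl
  rw [h, MeasurableEquiv.map_apply,
    show cellCoord ψ b ⁻¹' {s} = {(cellCoord ψ b).symm s} by
      ext y; exact (cellCoord ψ b).toEquiv.eq_symm_apply.symm]
  exact measure_singleton _

lemma restrict_cellMatched (hμ : ∀ r : ℝ, μ (Metric.ball 0 r) < ⊤) :
    (μ.restrict (cellMatched ψ ρ z z' μ ν A A' b)).map (cellCoord ψ b) =
      (cellMeasure ψ ρ z μ A b).restrict {s | (cellMeasure ψ ρ z μ A b).real (Iic s) <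
        min ((cellMeasure ψ ρ z μ A b).real univ) ((cellMeasure ψ ρ z' ν A' b).real univ)} := by
  have := isFiniteMeasure_cellMeasure ψ ρ z b hμ A
  have hs : MeasurableSet {s | (cellMeasure ψ ρ z μ A b).real (Iic s) <
      min ((cellMeasure ψ ρ z μ A b).real univ) ((cellMeasure ψ ρ z' ν A' b).real univ)} :=
    measurableSet_lt (measurable_real_Iic _) measurable_const
  change _ = ((μ.restrict (A ∩ Metric.ball (b + z) ρ)).map (cellCoord ψ b)).restrict {s | _}
  rw [Measure.restrict_map (cellCoord ψ b).measurable hs, Measure.restrict_restrict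
    ((cellCoord ψ b).measurable hs), inter_comm]
  rfl

lemma measurableSet_cellMatched (hμ : ∀ r : ℝ, μ (Metric.ball 0 r) < ⊤) (hA : MeasurableSet A) :
    MeasurableSet (cellMatched ψ ρ z z' μ ν A A' b) := by
  have := isFiniteMeasure_cellMeasure ψ ρ z b hμ A
  refine (hA.inter Metric.isOpen_ball.measurableSet).inter (measurableSet_lt ?_ measurable_const)
  exact (measurable_real_Iic _).comp (cellCoord ψ b).measurable

lemma measurable_cellMap (hμ : ∀ r : ℝ, μ (Metric.ball 0 r) < ⊤)
    (hν : ∀ r : ℝ, ν (Metric.ball 0 r) < ⊤) :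
    Measurable (cellMap ψ ρ z z' μ ν A A' b) := by
  have := isFiniteMeasure_cellMeasure ψ ρ z b hμ A
  have := isFiniteMeasure_cellMeasure ψ ρ z' b hν A'
  exact (ψ.symm.measurable.comp ((measurable_lineTransport _ _).comp
    (cellCoord ψ b).measurable)).const_add b

lemma map_cellMap [NullSingletonClass μ] [NullSingletonClass ν]
    (hμ : ∀ r : ℝ, μ (Metric.ball 0 r) < ⊤) (hν : ∀ r : ℝ, ν (Metric.ball 0 r) < ⊤) :
    (μ.restrict (cellMatched ψ ρ z z' μ ν A A' b)).map (cellMap ψ ρ z z' μ ν A A' b) =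
      ν.restrict (cellMatched ψ ρ z' z ν μ A' A b) := by
  have := isFiniteMeasure_cellMeasure ψ ρ z b hμ A
  have := isFiniteMeasure_cellMeasure ψ ρ z' b hν A'
  have := nullSingletonClass_cellMeasure ψ ρ z b (μ := μ) A
  have := nullSingletonClass_cellMeasure ψ ρ z' b (μ := ν) A'
  have h : cellMap ψ ρ z z' μ ν A A' b = (cellCoord ψ b).symm ∘
      lineTransport (cellMeasure ψ ρ z μ A b) (cellMeasure ψ ρ z' ν A' b) ∘ cellCoord ψ b := by
    ext y
    simp only [Function.comp, cellCoord_symm_apply]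
    rfl
  rw [h, ← Measure.map_map (cellCoord ψ b).symm.measurable
    ((measurable_lineTransport _ _).comp (cellCoord ψ b).measurable),
    ← Measure.map_map (measurable_lineTransport _ _) (cellCoord ψ b).measurable,
    restrict_cellMatched ψ ρ z z' b hμ, map_lineTransport _ _ (min_le_left _ _)
      (min_le_right _ _), min_comm, ← restrict_cellMatched ψ ρ z' z b hν,
    MeasurableEquiv.map_symm_map]

lemma cellMap_leftInverse [NullSingletonClass μ] [NullSingletonClass ν]
    (hμ : ∀ r : ℝ, μ (Metric.ball 0 r) < ⊤) (hν : ∀ r : ℝ, ν (Metric.ball 0 r) < ⊤) :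
    ∀ᵐ y ∂(μ.restrict (cellMatched ψ ρ z z' μ ν A A' b)),
      cellMap ψ ρ z' z ν μ A' A b (cellMap ψ ρ z z' μ ν A A' b y) = y := by
  have := isFiniteMeasure_cellMeasure ψ ρ z b hμ A
  have := isFiniteMeasure_cellMeasure ψ ρ z' b hν A'
  have := nullSingletonClass_cellMeasure ψ ρ z b (μ := μ) A
  have := nullSingletonClass_cellMeasure ψ ρ z' b (μ := ν) A'
  have h := lineTransport_leftInverse (cellMeasure ψ ρ z μ A b) (cellMeasure ψ ρ z' ν A' b)
    (min_le_left _ _) (min_le_right _ _)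
  rw [← restrict_cellMatched ψ ρ z z' b hμ] at h
  filter_upwards [ae_of_ae_map (cellCoord ψ b).measurable.aemeasurable h] with y hy
  rw [cellCoord_apply] at hy
  simp only [cellMap, add_sub_cancel_left, MeasurableEquiv.apply_symm_apply, hy]
  simp

lemma measure_cellMatched_compl [NullSingletonClass μ] [NullSingletonClass ν]
    (hμ : ∀ r : ℝ, μ (Metric.ball 0 r) < ⊤) (hν : ∀ r : ℝ, ν (Metric.ball 0 r) < ⊤) :
    μ ((A ∩ Metric.ball (b + z) ρ) \ cellMatched ψ ρ z z' μ ν A A' b) = 0 ∨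
      ν ((A' ∩ Metric.ball (b + z') ρ) \ cellMatched ψ ρ z' z ν μ A' A b) = 0 := by
  have key : ∀ (z z' : X) (μ ν : Measure X) (A A' : Set X) (_ : ∀ r : ℝ, μ (Metric.ball 0 r) < ⊤)
      (_ : NullSingletonClass μ),
      (cellMeasure ψ ρ z μ A b).real univ ≤ (cellMeasure ψ ρ z' ν A' b).real univ →
      μ ((A ∩ Metric.ball (b + z) ρ) \ cellMatched ψ ρ z z' μ ν A A' b) = 0 := by
    intro z z' μ ν A A' hμ _ hle
    have := isFiniteMeasure_cellMeasure ψ ρ z b hμ A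
    have := nullSingletonClass_cellMeasure ψ ρ z b (μ := μ) A
    have h := measure_setOf_real_Iic_ge (cellMeasure ψ ρ z μ A b)
    have hs : MeasurableSet {s | ¬ (cellMeasure ψ ρ z μ A b).real (Iic s) <
        (cellMeasure ψ ρ z μ A b).real univ} :=
      (measurableSet_lt (measurable_real_Iic _) measurable_const).compl
    change (μ.restrict (A ∩ Metric.ball (b + z) ρ)).map (cellCoord ψ b) {s | _} = 0 at h
    rw [Measure.map_apply (cellCoord ψ b).measurable hs,
      Measure.restrict_apply ((cellCoord ψ b).measurable hs)] at h
    rw [cellMatched, min_eq_left hle, sdiff_self_inter]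
    refine measure_mono_null ?_ h
    rintro y ⟨hy, hy'⟩
    exact ⟨hy', hy⟩
  rcases le_total ((cellMeasure ψ ρ z μ A b).real univ)
    ((cellMeasure ψ ρ z' ν A' b).real univ) with h | h
  · exact Or.inl (key z z' μ ν A A' hμ inferInstance h)
  · exact Or.inr (key z' z ν μ A' A hν inferInstance h)

end Cells

section Matching

open ProbabilityTheory

variable {X M : Type*} [NormedAddCommGroup X] [NormedSpace ℝ X] [FiniteDimensional ℝ X]
  [MeasurableSpace X] [BorelSpace X] [MeasurableSpace M] {σ : X → M → M} {P : Measure M}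
  {ρ : ℝ} {D : Set (M × X)} {β : M × X → X}

/-- The part of `A` which is matched to `A'` when every ball of the family, shifted by `z`, is
matched with the same ball shifted by `z'`. -/
def matched (ψ : X ≃ᵐ ℝ) (ρ : ℝ) (D : Set (M × X)) (β : M × X → X) (z z' : X) (ζ ζ' : Kernel M X)
    (A A' : Set (M × X)) : Set (M × X) :=
  {q | (q.1, q.2 - z) ∈ D ∧ q.2 ∈ cellMatched ψ ρ z z' (ζ q.1) (ζ' q.1) (Prod.mk q.1 ⁻¹' A)
    (Prod.mk q.1 ⁻¹' A') (β (q.1, q.2 - z))}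

/-- The matching of the balls of the family shifted by `z` with those shifted by `z'`. -/
def matchMap (ψ : X ≃ᵐ ℝ) (ρ : ℝ) (β : M × X → X) (z z' : X) (ζ ζ' : Kernel M X)
    (A A' : Set (M × X)) (q : M × X) : X :=
  cellMap ψ ρ z z' (ζ q.1) (ζ' q.1) (Prod.mk q.1 ⁻¹' A) (Prod.mk q.1 ⁻¹' A') (β (q.1, q.2 - z)) q.2

/-- The centres of the balls of the family. -/
def centres (D : Set (M × X)) (β : M × X → X) (m : M) : Set X := (fun y => β (m, y)) '' {y | (m, y) ∈ D}

lemma IsBallFamily.centre_mem (hD : IsBallFamily σ P ρ D β) {m : M} {b : X}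
    (hb : b ∈ centres D β m) : (m, b) ∈ D ∧ β (m, b) = b := by
  obtain ⟨y, hy, rfl⟩ := hb
  exact hD.of_mem_ball m y hy _ (Metric.mem_ball_self hD.pos)

lemma IsBallFamily.of_mem_centre (hD : IsBallFamily σ P ρ D β) {m : M} {b z y : X}
    (hb : b ∈ centres D β m) (hy : y ∈ Metric.ball (b + z) ρ) :
    (m, y - z) ∈ D ∧ β (m, y - z) = b := by
  obtain ⟨h1, h2⟩ := hD.centre_mem hb
  have := hD.of_mem_ball m b h1 (y - z) (by
    rw [h2, Metric.mem_ball, ← dist_add_right _ _ z, sub_add_cancel]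
    exact hy)
  rwa [h2] at this

lemma IsBallFamily.disjoint_ball (hD : IsBallFamily σ P ρ D β) (m : M) (z : X) :
    Pairwise (Function.onFun Disjoint fun b : centres D β m => Metric.ball ((b : X) + z) ρ) := by
  intro b b' hbb
  rw [Function.onFun, disjoint_left]
  intro y hy hy'
  exact hbb (Subtype.ext ((hD.of_mem_centre b.2 hy).2.symm.trans (hD.of_mem_centre b'.2 hy').2))

lemma IsBallFamily.countable_centres (hD : IsBallFamily σ P ρ D β) (m : M) :
    Countable (centres D β m) := by
  have h := hD.disjoint_ball m 0
  have hpos := hD.pos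
  have := Pairwise.countable_of_isOpen_disjoint h (fun _ => Metric.isOpen_ball)
    (fun b => ⟨_, Metric.mem_ball_self hpos⟩)
  exact this

lemma IsBallFamily.matched_eq_iUnion (hD : IsBallFamily σ P ρ D β) (ψ : X ≃ᵐ ℝ) (z z' : X)
    (ζ ζ' : Kernel M X) (A A' : Set (M × X)) (m : M) :
    Prod.mk m ⁻¹' matched ψ ρ D β z z' ζ ζ' A A' = ⋃ b : centres D β m,
      cellMatched ψ ρ z z' (ζ m) (ζ' m) (Prod.mk m ⁻¹' A) (Prod.mk m ⁻¹' A') b := by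
  ext y
  simp only [mem_iUnion]
  constructor
  · rintro ⟨h1, h2⟩
    exact ⟨⟨_, _, h1, rfl⟩, h2⟩
  · rintro ⟨b, hb⟩
    obtain ⟨h1, h2⟩ := hD.of_mem_centre b.2 hb.1.2
    exact ⟨h1, by rw [h2]; exact hb⟩

lemma IsBallFamily.restrict_matched (hD : IsBallFamily σ P ρ D β) (ψ : X ≃ᵐ ℝ) (z z' : X)
    {ζ : Kernel M X} (ζ' : Kernel M X) {A : Set (M × X)} (A' : Set (M × X)) (m : M)
    (hζ : ∀ r : ℝ, ζ m (Metric.ball 0 r) < ⊤) (hA : MeasurableSet A) :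
    (ζ m).restrict (Prod.mk m ⁻¹' matched ψ ρ D β z z' ζ ζ' A A') =
      Measure.sum fun b : centres D β m => (ζ m).restrict
        (cellMatched ψ ρ z z' (ζ m) (ζ' m) (Prod.mk m ⁻¹' A) (Prod.mk m ⁻¹' A') b) := by
  have := hD.countable_centres m
  rw [hD.matched_eq_iUnion]
  refine Measure.restrict_iUnion ?_ fun b =>
    measurableSet_cellMatched ψ ρ z z' b hζ (measurable_prodMk_left hA)
  intro b b' hbb
  exact (hD.disjoint_ball m z hbb).mono (fun _ h => h.1.2) fun _ h => h.1.2

lemma IsBallFamily.matchMap_eq (hD : IsBallFamily σ P ρ D β) (ψ : X ≃ᵐ ℝ) {z : X} (z' : X)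
    (ζ ζ' : Kernel M X) (A A' : Set (M × X)) {m : M} {b : X} (hb : b ∈ centres D β m) {y : X}
    (hy : y ∈ cellMatched ψ ρ z z' (ζ m) (ζ' m) (Prod.mk m ⁻¹' A) (Prod.mk m ⁻¹' A') b) :
    matchMap ψ ρ β z z' ζ ζ' A A' (m, y) =
      cellMap ψ ρ z z' (ζ m) (ζ' m) (Prod.mk m ⁻¹' A) (Prod.mk m ⁻¹' A') b y := by
  simp only [matchMap, (hD.of_mem_centre hb hy.1.2).2]

lemma IsBallFamily.map_matchMap (hD : IsBallFamily σ P ρ D β) (ψ : X ≃ᵐ ℝ) (z z' : X)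
    {ζ ζ' : Kernel M X} {A A' : Set (M × X)} {m : M} [NullSingletonClass (ζ m)]
    [NullSingletonClass (ζ' m)]
    (hζ : ∀ r : ℝ, ζ m (Metric.ball 0 r) < ⊤) (hζ' : ∀ r : ℝ, ζ' m (Metric.ball 0 r) < ⊤)
    (hA : MeasurableSet A) (hA' : MeasurableSet A')
    (hm : Measurable fun y => matchMap ψ ρ β z z' ζ ζ' A A' (m, y)) :
    ((ζ m).restrict (Prod.mk m ⁻¹' matched ψ ρ D β z z' ζ ζ' A A')).map
      (fun y => matchMap ψ ρ β z z' ζ ζ' A A' (m, y)) =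
      (ζ' m).restrict (Prod.mk m ⁻¹' matched ψ ρ D β z' z ζ' ζ A' A) := by
  have := hD.countable_centres m
  rw [hD.restrict_matched ψ z z' ζ' A' m hζ hA, hD.restrict_matched ψ z' z ζ A m hζ' hA',
    Measure.map_sum hm.aemeasurable]
  congr 1
  ext1 b
  rw [← map_cellMap ψ ρ z z' b hζ hζ']
  refine Measure.map_congr ?_
  filter_upwards [ae_restrict_mem (measurableSet_cellMatched ψ ρ z z' b hζ
    (measurable_prodMk_left hA))] with y hy
  exact hD.matchMap_eq ψ z' ζ ζ' A A' b.2 hy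

lemma IsBallFamily.matchMap_leftInverse (hD : IsBallFamily σ P ρ D β) (ψ : X ≃ᵐ ℝ) (z z' : X)
    {ζ ζ' : Kernel M X} {A A' : Set (M × X)} {m : M} [NullSingletonClass (ζ m)]
    [NullSingletonClass (ζ' m)]
    (hζ : ∀ r : ℝ, ζ m (Metric.ball 0 r) < ⊤) (hζ' : ∀ r : ℝ, ζ' m (Metric.ball 0 r) < ⊤)
    (hA : MeasurableSet A) (hA' : MeasurableSet A') :
    ∀ᵐ y ∂(ζ m).restrict (Prod.mk m ⁻¹' matched ψ ρ D β z z' ζ ζ' A A'),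
      (m, matchMap ψ ρ β z z' ζ ζ' A A' (m, y)) ∈ matched ψ ρ D β z' z ζ' ζ A' A ∧
      matchMap ψ ρ β z' z ζ' ζ A' A (m, matchMap ψ ρ β z z' ζ ζ' A A' (m, y)) = y := by
  have := hD.countable_centres m
  rw [hD.restrict_matched ψ z z' ζ' A' m hζ hA, Measure.ae_sum_iff]
  intro b
  have h1 := ae_restrict_mem (μ := ζ' m) (measurableSet_cellMatched (μ := ζ' m) (ν := ζ m)
    (A := Prod.mk m ⁻¹' A') (A' := Prod.mk m ⁻¹' A) ψ ρ z' z b hζ' (measurable_prodMk_left hA'))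
  rw [← map_cellMap ψ ρ z z' b hζ hζ'] at h1
  filter_upwards [ae_restrict_mem (measurableSet_cellMatched ψ ρ z z' b hζ
      (measurable_prodMk_left hA)), cellMap_leftInverse ψ ρ z z' b hζ hζ',
    ae_of_ae_map (measurable_cellMap ψ ρ z z' b hζ hζ').aemeasurable h1] with y hy h2 h3
  rw [hD.matchMap_eq ψ z' ζ ζ' A A' b.2 hy, hD.matchMap_eq ψ z ζ' ζ A' A b.2 h3]
  refine ⟨?_, h2⟩
  rw [← mem_preimage, hD.matched_eq_iUnion]
  exact mem_iUnion.2 ⟨b, h3⟩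

lemma IsBallFamily.measure_matched_compl (hD : IsBallFamily σ P ρ D β) (ψ : X ≃ᵐ ℝ) (z z' : X)
    {ζ ζ' : Kernel M X} {A A' : Set (M × X)} {m : M} [NullSingletonClass (ζ m)]
    [NullSingletonClass (ζ' m)]
    (hζ : ∀ r : ℝ, ζ m (Metric.ball 0 r) < ⊤) (hζ' : ∀ r : ℝ, ζ' m (Metric.ball 0 r) < ⊤)
    {b : X} (hb : b ∈ centres D β m) :
    ζ m ((Prod.mk m ⁻¹' (A \ matched ψ ρ D β z z' ζ ζ' A A')) ∩ Metric.ball (b + z) ρ) = 0 ∨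
    ζ' m ((Prod.mk m ⁻¹' (A' \ matched ψ ρ D β z' z ζ' ζ A' A)) ∩ Metric.ball (b + z') ρ) = 0 := by
  have key : ∀ (z z' : X) (ζ ζ' : Kernel M X) (A A' : Set (M × X)),
      (Prod.mk m ⁻¹' (A \ matched ψ ρ D β z z' ζ ζ' A A')) ∩ Metric.ball (b + z) ρ ⊆
      ((Prod.mk m ⁻¹' A) ∩ Metric.ball (b + z) ρ) \ cellMatched ψ ρ z z' (ζ m) (ζ' m)
        (Prod.mk m ⁻¹' A) (Prod.mk m ⁻¹' A') b := by
    rintro z z' ζ ζ' A A' y ⟨⟨h1, h2⟩, h3⟩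
    refine ⟨⟨h1, h3⟩, fun h4 => h2 ?_⟩
    rw [← mem_preimage, hD.matched_eq_iUnion]
    exact mem_iUnion.2 ⟨⟨b, hb⟩, h4⟩
  exact (measure_cellMatched_compl ψ ρ z z' b hζ hζ').imp (measure_mono_null (key _ _ _ _ _ _))
    (measure_mono_null (key _ _ _ _ _ _))

lemma cellMeasure_map_sub (ψ : X ≃ᵐ ℝ) (ρ : ℝ) (z x b : X) (μ : Measure X) {A A' : Set X}
    (hA : ∀ y, y ∈ A' ↔ y + x ∈ A) (hA' : MeasurableSet A') :
    cellMeasure ψ ρ z (μ.map fun y => y - x) A' (b - x) = cellMeasure ψ ρ z μ A b := by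
  change ((μ.map fun y => y - x).restrict (A' ∩ Metric.ball (b - x + z) ρ)).map
    (cellCoord ψ (b - x)) = (μ.restrict (A ∩ Metric.ball (b + z) ρ)).map (cellCoord ψ b)
  rw [Measure.restrict_map (measurable_sub_const x)
    (hA'.inter Metric.isOpen_ball.measurableSet),
    Measure.map_map (cellCoord ψ (b - x)).measurable (measurable_sub_const x)]
  congr 1
  · ext y
    simp [cellCoord_apply]
  · congr 1
    ext y
    simp only [mem_preimage, mem_inter_iff, hA, sub_add_cancel, Metric.mem_ball]
    rw [show b - x + z = b + z - x by abel, dist_sub_right]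

lemma IsBallFamily.matched_equiv (hD : IsBallFamily σ P ρ D β) (ψ : X ≃ᵐ ℝ) (z z' : X)
    {ζ ζ' : Kernel M X} {A A' : Set (M × X)}
    (hζ : IsEquivariantKernel σ ζ) (hζ' : IsEquivariantKernel σ ζ')
    (hA : MeasurableSet A) (hA' : MeasurableSet A')
    (hAσ : ∀ m x y, (σ x m, y) ∈ A ↔ (m, y + x) ∈ A)
    (hAσ' : ∀ m x y, (σ x m, y) ∈ A' ↔ (m, y + x) ∈ A') (m : M) (x y : X) :
    ((σ x m, y) ∈ matched ψ ρ D β z z' ζ ζ' A A' ↔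
      (m, y + x) ∈ matched ψ ρ D β z z' ζ ζ' A A') ∧
    matchMap ψ ρ β z z' ζ ζ' A A' (σ x m, y) = matchMap ψ ρ β z z' ζ ζ' A A' (m, y + x) - x := by
  have h1 : β (σ x m, y - z) = β (m, y + x - z) - x := by
    rw [hD.centre_equiv, show y - z + x = y + x - z by abel]
  have h2 := fun b => cellMeasure_map_sub ψ ρ z x b (ζ m) (A := Prod.mk m ⁻¹' A)
    (A' := Prod.mk (σ x m) ⁻¹' A) (hAσ m x) (measurable_prodMk_left hA)
  have h3 := fun b => cellMeasure_map_sub ψ ρ z' x b (ζ' m) (A := Prod.mk m ⁻¹' A')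
    (A' := Prod.mk (σ x m) ⁻¹' A') (hAσ' m x) (measurable_prodMk_left hA')
  have h4 : ∀ b, y - (b - x) = y + x - b := fun b => by abel
  constructor
  · simp only [matched, cellMatched]
    refine and_congr ?_ ?_
    · change (σ x m, y - z) ∈ D ↔ (m, y + x - z) ∈ D
      rw [hD.mem_equiv, show y - z + x = y + x - z by abel]
    · simp only [h1, hζ.apply_flow, hζ'.apply_flow, h2, h3]
      refine and_congr (and_congr (hAσ m x y) ?_) ?_
      · rw [Metric.mem_ball, Metric.mem_ball, ← dist_add_right y _ x]
        congr! 2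
        abel
      · simp only [mem_ofPred_eq, h4]
  · simp only [matchMap, cellMap, h1, hζ.apply_flow, hζ'.apply_flow, h2, h3, h4]
    abel

end Matching

section MatchingMeasurable

open ProbabilityTheory

variable {X M : Type*} [NormedAddCommGroup X] [NormedSpace ℝ X] [FiniteDimensional ℝ X]
  [MeasurableSpace X] [BorelSpace X] [MeasurableSpace M] {σ : X → M → M} {P : Measure M}
  {ρ : ℝ} {D : Set (M × X)} {β : M × X → X}

lemma measurable_cellMeasure_section {Y : Type*} [MeasurableSpace Y] (ψ : X ≃ᵐ ℝ) (ρ : ℝ) (z : X)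
    (ζ : Kernel M X) [IsSFiniteKernel ζ] {A : Set (M × X)} (hA : MeasurableSet A) {g : Y → M}
    (hg : Measurable g) {b : Y → X} (hb : Measurable b) {S : Set (Y × ℝ)} (hS : MeasurableSet S) :
    Measurable fun y => cellMeasure ψ ρ z (ζ (g y)) (Prod.mk (g y) ⁻¹' A) (b y)
      (Prod.mk y ⁻¹' S) := by
  have hC : MeasurableSet {p : Y × X | (p.1, ψ (p.2 - b p.1)) ∈ S ∧ (g p.1, p.2) ∈ A ∧
      p.2 ∈ Metric.ball (b p.1 + z) ρ} := by
    refine MeasurableSet.inter ?_ (MeasurableSet.inter ?_ ?_)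
    · exact (measurable_fst.prodMk (ψ.measurable.comp
        (measurable_snd.sub (hb.comp measurable_fst)))) hS
    · exact ((hg.comp measurable_fst).prodMk measurable_snd) hA
    · exact measurableSet_lt (measurable_snd.dist ((hb.comp measurable_fst).add_const z))
        measurable_const
  convert (Kernel.measurable_kernel_prodMk_left (κ := ζ.comap g hg) hC) using 2 with y
  have h1 : MeasurableSet (Prod.mk y ⁻¹' S) := measurable_prodMk_left hS
  change (((ζ (g y)).restrict _).map (cellCoord ψ (b y))) _ = _
  rw [Measure.map_apply (cellCoord ψ (b y)).measurable h1,
    Measure.restrict_apply ((cellCoord ψ (b y)).measurable h1)]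
  rfl

lemma measurable_cellMeasure {Y : Type*} [MeasurableSpace Y] (ψ : X ≃ᵐ ℝ) (ρ : ℝ) (z : X)
    (ζ : Kernel M X) [IsSFiniteKernel ζ] {A : Set (M × X)} (hA : MeasurableSet A) {g : Y → M}
    (hg : Measurable g) {b : Y → X} (hb : Measurable b) :
    Measurable fun y => cellMeasure ψ ρ z (ζ (g y)) (Prod.mk (g y) ⁻¹' A) (b y) :=
  Measure.measurable_of_measurable_coe _ fun _ hs =>
    measurable_cellMeasure_section ψ ρ z ζ hA hg hb (measurable_snd hs)

lemma measurable_cellMeasure_Iic {Y : Type*} [MeasurableSpace Y] (ψ : X ≃ᵐ ℝ) (ρ : ℝ) (z : X)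
    (ζ : Kernel M X) [IsSFiniteKernel ζ] {A : Set (M × X)} (hA : MeasurableSet A) {g : Y → M}
    (hg : Measurable g) {b : Y → X} (hb : Measurable b) {t : Y → ℝ} (ht : Measurable t) :
    Measurable fun y => (cellMeasure ψ ρ z (ζ (g y)) (Prod.mk (g y) ⁻¹' A) (b y)).real
      (Iic (t y)) := by
  have hS : MeasurableSet {p : Y × ℝ | p.2 ≤ t p.1} :=
    measurableSet_le measurable_snd (ht.comp measurable_fst)
  exact (measurable_cellMeasure_section ψ ρ z ζ hA hg hb hS).ennreal_toReal

lemma measurableSet_matched (hD : IsBallFamily σ P ρ D β) (ψ : X ≃ᵐ ℝ) (z z' : X)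
    (ζ ζ' : Kernel M X) [IsSFiniteKernel ζ] [IsSFiniteKernel ζ'] {A A' : Set (M × X)}
    (hA : MeasurableSet A) (hA' : MeasurableSet A') :
    MeasurableSet (matched ψ ρ D β z z' ζ ζ' A A') := by
  have hs : Measurable fun q : M × X => (q.1, q.2 - z) :=
    measurable_fst.prodMk (measurable_snd.sub_const z)
  have hb : Measurable fun q : M × X => β (q.1, q.2 - z) := hD.measurable.comp hs
  refine MeasurableSet.inter (hs hD.measurableSet) (MeasurableSet.inter (MeasurableSet.inter hA
    (measurableSet_lt (measurable_snd.dist (hb.add_const z)) measurable_const)) ?_)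
  refine measurableSet_lt (measurable_cellMeasure_Iic ψ ρ z ζ hA measurable_fst hb
    (ψ.measurable.comp (measurable_snd.sub hb))) (Measurable.min ?_ ?_)
  · exact ((measurable_cellMeasure_section ψ ρ z ζ hA measurable_fst hb
      MeasurableSet.univ)).ennreal_toReal
  · exact ((measurable_cellMeasure_section ψ ρ z' ζ' hA' measurable_fst hb
      MeasurableSet.univ)).ennreal_toReal

lemma measurable_matchMap (hD : IsBallFamily σ P ρ D β) (ψ : X ≃ᵐ ℝ) (z z' : X)
    (ζ ζ' : Kernel M X) [IsSFiniteKernel ζ] [IsSFiniteKernel ζ'] {A A' : Set (M × X)}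
    (hζ' : IsEquivariantKernel σ ζ')
    (hA : MeasurableSet A) (hA' : MeasurableSet A') :
    Measurable (matchMap ψ ρ β z z' ζ ζ' A A') := by
  have hs : Measurable fun q : M × X => (q.1, q.2 - z) :=
    measurable_fst.prodMk (measurable_snd.sub_const z)
  have hb : Measurable fun q : M × X => β (q.1, q.2 - z) := hD.measurable.comp hs
  refine hb.add (ψ.symm.measurable.comp ?_)
  exact (measurable_lineQuantile_kernel _
    (fun q : M × X => isFiniteMeasure_cellMeasure ψ ρ z' _ (hζ'.ball_lt_top q.1) _)
    (measurable_cellMeasure ψ ρ z' ζ' hA' measurable_fst hb)).comp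
    (measurable_id.prodMk (measurable_cellMeasure_Iic ψ ρ z ζ hA measurable_fst hb
      (ψ.measurable.comp (measurable_snd.sub hb))))

end MatchingMeasurable

section Leftover

open ProbabilityTheory

variable {X M : Type*} [NormedAddCommGroup X] [NormedSpace ℝ X] [FiniteDimensional ℝ X]
  [MeasurableSpace X] [BorelSpace X] [MeasurableSpace M] {σ : X → M → M} {P : Measure M}
  {ρ : ℝ} {D : Set (M × X)} {β : M × X → X}

/-- A set in the product which is compatible with the flow. -/
def IsInvariantSet (σ : X → M → M) (A : Set (M × X)) : Prop :=
  ∀ m x y, (σ x m, y) ∈ A ↔ (m, y + x) ∈ A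

/-- A map on the product which is compatible with the flow. -/
def IsEquivariantMap (σ : X → M → M) (T : M × X → X) : Prop :=
  ∀ m x y, T (σ x m, y) = T (m, y + x) - x

/-- Gluing equivariant maps along disjoint invariant sets. -/
lemma exists_glued {s : ℕ → Set (M × X)} (hs : ∀ n, MeasurableSet (s n))
    (hd : Pairwise (Function.onFun Disjoint s)) (hsσ : ∀ n, IsInvariantSet σ (s n))
    {f : ℕ → M × X → X} (hf : ∀ n, Measurable (f n)) (hfσ : ∀ n, IsEquivariantMap σ (f n)) :
    ∃ F, Measurable F ∧ IsEquivariantMap σ F ∧ ∀ n, EqOn F (f n) (s n) := by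
  have ht : Pairwise fun i j : Option ℕ =>
      EqOn (i.elim Prod.snd f : M × X → X) (j.elim Prod.snd f)
        ((i.elim (⋃ n, s n)ᶜ s) ∩ (j.elim (⋃ n, s n)ᶜ s)) := by
    rintro (_ | i) (_ | j) hij q ⟨h1, h2⟩
    · exact absurd rfl hij
    · exact absurd (mem_iUnion.2 ⟨j, h2⟩) h1
    · exact absurd (mem_iUnion.2 ⟨i, h1⟩) h2
    · exact absurd h2 (disjoint_left.1 (hd fun h => hij (congrArg some h)) h1)
  obtain ⟨F, hF, hFe⟩ := exists_measurable_piecewise (fun i : Option ℕ => i.elim (⋃ n, s n)ᶜ s)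
    (by rintro (_ | i); exacts [(MeasurableSet.iUnion hs).compl, hs i])
    (fun i : Option ℕ => (i.elim Prod.snd f : M × X → X))
    (by rintro (_ | i); exacts [measurable_snd, hf i]) ht
  refine ⟨F, hF, fun m x y => ?_, fun n => hFe (some n)⟩
  by_cases h : ∃ n, (m, y + x) ∈ s n
  · obtain ⟨n, hn⟩ := h
    rw [hFe (some n) hn, hFe (some n) ((hsσ n m x y).2 hn)]
    exact hfσ n m x y
  · have h1 : (m, y + x) ∈ (⋃ n, s n)ᶜ := by simpa using h
    have h2 : (σ x m, y) ∈ (⋃ n, s n)ᶜ := by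
      simp only [mem_compl_iff, mem_iUnion, hsσ _ m x y]
      exact h
    rw [hFe none h1, hFe none h2]
    simp

/-- The shift of the balls used in the `n`-th round. -/
def shift (X : Type*) [TopologicalSpace X] [TopologicalSpace.SeparableSpace X] [Nonempty X]
    (n : ℕ) : X × X :=
  (TopologicalSpace.denseSeq X n.unpair.1, TopologicalSpace.denseSeq X n.unpair.2)

/-- The parts of the two measures which are unmatched before round `n`. -/
def leftover (ψ : X ≃ᵐ ℝ) (ρ : ℝ) (D : Set (M × X)) (β : M × X → X) (ζ ζ' : Kernel M X) :
    ℕ → Set (M × X) × Set (M × X)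
  | 0 => (univ, univ)
  | n + 1 =>
    ((leftover ψ ρ D β ζ ζ' n).1 \ matched ψ ρ D β (shift X n).1 (shift X n).2 ζ ζ'
      (leftover ψ ρ D β ζ ζ' n).1 (leftover ψ ρ D β ζ ζ' n).2,
    (leftover ψ ρ D β ζ ζ' n).2 \ matched ψ ρ D β (shift X n).2 (shift X n).1 ζ' ζ
      (leftover ψ ρ D β ζ ζ' n).2 (leftover ψ ρ D β ζ ζ' n).1)

lemma matched_subset (ψ : X ≃ᵐ ℝ) (z z' : X) (ζ ζ' : Kernel M X) (A A' : Set (M × X)) :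
    matched ψ ρ D β z z' ζ ζ' A A' ⊆ A := fun _ h => h.2.1.1

lemma leftover_measurable (hD : IsBallFamily σ P ρ D β) (ψ : X ≃ᵐ ℝ) (ζ ζ' : Kernel M X)
    [IsSFiniteKernel ζ] [IsSFiniteKernel ζ'] (n : ℕ) :
    MeasurableSet (leftover ψ ρ D β ζ ζ' n).1 ∧ MeasurableSet (leftover ψ ρ D β ζ ζ' n).2 := by
  induction n with
  | zero => exact ⟨MeasurableSet.univ, MeasurableSet.univ⟩
  | succ n ih =>
    exact ⟨ih.1.diff (measurableSet_matched hD ψ _ _ ζ ζ' ih.1 ih.2),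
      ih.2.diff (measurableSet_matched hD ψ _ _ ζ' ζ ih.2 ih.1)⟩

lemma leftover_invariant (hD : IsBallFamily σ P ρ D β) (ψ : X ≃ᵐ ℝ) {ζ ζ' : Kernel M X}
    (hζ : IsEquivariantKernel σ ζ) (hζ' : IsEquivariantKernel σ ζ')
    [IsSFiniteKernel ζ] [IsSFiniteKernel ζ'] (n : ℕ) :
    IsInvariantSet σ (leftover ψ ρ D β ζ ζ' n).1 ∧
      IsInvariantSet σ (leftover ψ ρ D β ζ ζ' n).2 := by
  induction n with
  | zero => exact ⟨fun _ _ _ => Iff.rfl, fun _ _ _ => Iff.rfl⟩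
  | succ n ih =>
    obtain ⟨h1, h2⟩ := leftover_measurable hD ψ ζ ζ' n
    exact ⟨fun m x y => and_congr (ih.1 m x y)
        (not_congr (hD.matched_equiv ψ _ _ hζ hζ' h1 h2 ih.1 ih.2 m x y).1),
      fun m x y => and_congr (ih.2 m x y)
        (not_congr (hD.matched_equiv ψ _ _ hζ' hζ h2 h1 ih.2 ih.1 m x y).1)⟩

lemma leftover_antitone (ψ : X ≃ᵐ ℝ) (ρ : ℝ) (D : Set (M × X)) (β : M × X → X)
    (ζ ζ' : Kernel M X) : Antitone (leftover ψ ρ D β ζ ζ') :=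
  antitone_nat_of_succ_le fun _ => ⟨sdiff_subset, sdiff_subset⟩

lemma pairwise_disjoint_of_sdiff {A s : ℕ → Set (M × X)} (hA : Antitone A)
    (hs : ∀ n, s n ⊆ A n) (hAs : ∀ n, A (n + 1) = A n \ s n) :
    Pairwise (Function.onFun Disjoint s) := by
  refine (pairwise_disjoint_on s).2 fun i j hij => disjoint_left.2 fun q hi hj => ?_
  have h := hA (Nat.succ_le_of_lt hij) (hs j hj)
  rw [Nat.succ_eq_add_one, hAs] at h
  exact h.2 hi

lemma compl_iUnion_subset_of_sdiff {A s : ℕ → Set (M × X)} (h0 : A 0 = univ)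
    (hAs : ∀ n, A (n + 1) = A n \ s n) (n : ℕ) : (⋃ n, s n)ᶜ ⊆ A n := by
  induction n with
  | zero => rw [h0]; exact subset_univ _
  | succ n ih =>
    rw [hAs]
    exact fun q hq => ⟨ih hq, fun h => hq (mem_iUnion.2 ⟨n, h⟩)⟩

/-- The matching of two atomless equivariant kernels of the same intensity. -/
theorem exists_matching [Nontrivial X] [IsProbabilityMeasure P] (hσ : IsErgodicFlow σ P)
    (hD : IsBallFamily σ P ρ D β) {ζ ζ' : Kernel M X}
    (hζ : IsEquivariantKernel σ ζ) (hζ' : IsEquivariantKernel σ ζ')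
    (hint : ∀ n : ℕ, ∫⁻ m, ζ m (Metric.ball 0 (n + 1)) ∂P =
      ∫⁻ m, ζ' m (Metric.ball 0 (n + 1)) ∂P)
    (hfin : ∀ n : ℕ, ∫⁻ m, ζ m (Metric.ball 0 (n + 1)) ∂P < ⊤)
    (hat : ∀ᵐ m ∂P, NullSingletonClass (ζ m)) (hat' : ∀ᵐ m ∂P, NullSingletonClass (ζ' m)) :
    ∃ F G : M × X → X, Measurable F ∧ Measurable G ∧ IsEquivariantMap σ F ∧
      IsEquivariantMap σ G ∧
      (∀ᵐ m ∂P, (ζ m).map (fun x => F (m, x)) = ζ' m) ∧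
      (∀ᵐ m ∂P, (ζ' m).map (fun x => G (m, x)) = ζ m) ∧
      ∀ᵐ m ∂P, ∀ᵐ x ∂(ζ m), G (m, F (m, x)) = x := by
  have := hζ.isSFiniteKernel
  have := hζ'.isSFiniteKernel
  have hcount : ¬ Countable X := by
    intro h
    obtain ⟨v, hv⟩ := exists_ne (0 : X)
    have : Countable ℝ := (smul_left_injective ℝ hv).countable
    exact Cardinal.not_countable_real (countable_univ)
  obtain ⟨ψ⟩ : Nonempty (X ≃ᵐ ℝ) := ⟨PolishSpace.measurableEquivOfNotCountable hcount
    fun _ => Cardinal.not_countable_real (countable_univ)⟩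
  set A : ℕ → Set (M × X) := fun n => (leftover ψ ρ D β ζ ζ' n).1
  set B : ℕ → Set (M × X) := fun n => (leftover ψ ρ D β ζ ζ' n).2
  set s : ℕ → Set (M × X) := fun n =>
    matched ψ ρ D β (shift X n).1 (shift X n).2 ζ ζ' (A n) (B n) with hs
  set t : ℕ → Set (M × X) := fun n =>
    matched ψ ρ D β (shift X n).2 (shift X n).1 ζ' ζ (B n) (A n) with ht
  set f : ℕ → M × X → X := fun n =>
    matchMap ψ ρ β (shift X n).1 (shift X n).2 ζ ζ' (A n) (B n)
  set g : ℕ → M × X → X := fun n =>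
    matchMap ψ ρ β (shift X n).2 (shift X n).1 ζ' ζ (B n) (A n)
  have hAm : ∀ n, MeasurableSet (A n) := fun n => (leftover_measurable hD ψ ζ ζ' n).1
  have hBm : ∀ n, MeasurableSet (B n) := fun n => (leftover_measurable hD ψ ζ ζ' n).2
  have hAσ : ∀ n, IsInvariantSet σ (A n) := fun n => (leftover_invariant hD ψ hζ hζ' n).1
  have hBσ : ∀ n, IsInvariantSet σ (B n) := fun n => (leftover_invariant hD ψ hζ hζ' n).2
  have hsm : ∀ n, MeasurableSet (s n) := fun n => measurableSet_matched hD ψ _ _ ζ ζ' (hAm n) (hBm n)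
  have htm : ∀ n, MeasurableSet (t n) := fun n => measurableSet_matched hD ψ _ _ ζ' ζ (hBm n) (hAm n)
  have hfm : ∀ n, Measurable (f n) := fun n => measurable_matchMap hD ψ _ _ ζ ζ' hζ' (hAm n) (hBm n)
  have hgm : ∀ n, Measurable (g n) := fun n => measurable_matchMap hD ψ _ _ ζ' ζ hζ (hBm n) (hAm n)
  have hsd : Pairwise (Function.onFun Disjoint s) := pairwise_disjoint_of_sdiff
    (A := A) (fun _ _ h => (leftover_antitone ψ ρ D β ζ ζ' h).1)
    (fun n => matched_subset ψ _ _ ζ ζ' _ _) fun n => rfl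
  have htd : Pairwise (Function.onFun Disjoint t) := pairwise_disjoint_of_sdiff
    (A := B) (fun _ _ h => (leftover_antitone ψ ρ D β ζ ζ' h).2)
    (fun n => matched_subset ψ _ _ ζ' ζ _ _) fun n => rfl
  have hsσ : ∀ n, IsInvariantSet σ (s n) := fun n m x y =>
    (hD.matched_equiv ψ _ _ hζ hζ' (hAm n) (hBm n) (hAσ n) (hBσ n) m x y).1
  have htσ : ∀ n, IsInvariantSet σ (t n) := fun n m x y =>
    (hD.matched_equiv ψ _ _ hζ' hζ (hBm n) (hAm n) (hBσ n) (hAσ n) m x y).1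
  obtain ⟨F, hF, hFσ, hFe⟩ := exists_glued hsm hsd hsσ hfm fun n m x y =>
    (hD.matched_equiv ψ _ _ hζ hζ' (hAm n) (hBm n) (hAσ n) (hBσ n) m x y).2
  obtain ⟨G, hG, hGσ, hGe⟩ := exists_glued htm htd htσ hgm fun n m x y =>
    (hD.matched_equiv ψ _ _ hζ' hζ (hBm n) (hAm n) (hBσ n) (hAσ n) m x y).2
  set C := ⋃ n, s n
  set C' := ⋃ n, t n
  have hC : MeasurableSet C := MeasurableSet.iUnion hsm
  have hC' : MeasurableSet C' := MeasurableSet.iUnion htm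
  have hCσ : IsInvariantSet σ C := fun m x y => by
    simp only [C, mem_iUnion, hsσ _ m x y]
  have hCσ' : IsInvariantSet σ C' := fun m x y => by
    simp only [C', mem_iUnion, htσ _ m x y]
  have hsum : ∀ m, (ζ m).restrict (Prod.mk m ⁻¹' C) =
      Measure.sum fun n => (ζ m).restrict (Prod.mk m ⁻¹' s n) := by
    intro m
    rw [preimage_iUnion]
    exact Measure.restrict_iUnion (fun i j hij => (hsd hij).preimage _)
      fun n => measurable_prodMk_left (hsm n)
  have hsum' : ∀ m, (ζ' m).restrict (Prod.mk m ⁻¹' C') =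
      Measure.sum fun n => (ζ' m).restrict (Prod.mk m ⁻¹' t n) := by
    intro m
    rw [preimage_iUnion]
    exact Measure.restrict_iUnion (fun i j hij => (htd hij).preimage _)
      fun n => measurable_prodMk_left (htm n)
  have hmap : ∀ᵐ m ∂P, ((ζ m).restrict (Prod.mk m ⁻¹' C)).map (fun x => F (m, x)) =
      (ζ' m).restrict (Prod.mk m ⁻¹' C') := by
    filter_upwards [hat, hat'] with m _ _
    rw [hsum, hsum', Measure.map_sum (f := fun x => F (m, x)) (hF.comp measurable_prodMk_left).aemeasurable]
    congr 1
    ext1 n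
    rw [← hD.map_matchMap ψ _ _ (hζ.ball_lt_top m) (hζ'.ball_lt_top m) (hAm n) (hBm n)
      ((hfm n).comp measurable_prodMk_left)]
    refine Measure.map_congr ?_
    filter_upwards [ae_restrict_mem (measurable_prodMk_left (hsm n))] with y hy
    exact hFe n hy
  have hmap' : ∀ᵐ m ∂P, ((ζ' m).restrict (Prod.mk m ⁻¹' C')).map (fun x => G (m, x)) =
      (ζ m).restrict (Prod.mk m ⁻¹' C) := by
    filter_upwards [hat, hat'] with m _ _
    rw [hsum, hsum', Measure.map_sum (f := fun x => G (m, x)) (hG.comp measurable_prodMk_left).aemeasurable]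
    congr 1
    ext1 n
    rw [← hD.map_matchMap ψ _ _ (hζ'.ball_lt_top m) (hζ.ball_lt_top m) (hBm n) (hAm n)
      ((hgm n).comp measurable_prodMk_left)]
    refine Measure.map_congr ?_
    filter_upwards [ae_restrict_mem (measurable_prodMk_left (htm n))] with y hy
    exact hGe n hy
  have hinv : ∀ᵐ m ∂P, ∀ᵐ x ∂((ζ m).restrict (Prod.mk m ⁻¹' C)), G (m, F (m, x)) = x := by
    filter_upwards [hat, hat'] with m _ _
    rw [hsum, Measure.ae_sum_iff]
    intro n
    filter_upwards [ae_restrict_mem (measurable_prodMk_left (hsm n)),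
      hD.matchMap_leftInverse ψ (shift X n).1 (shift X n).2 (hζ.ball_lt_top m)
        (hζ'.ball_lt_top m) (hAm n) (hBm n)] with y hy hy'
    rw [hFe n hy, hGe n hy'.1]
    exact hy'.2
  have hint' : ∀ n : ℕ, ∫⁻ m, fibreRestrict ζ hC.compl m (Metric.ball 0 (n + 1)) ∂P =
      ∫⁻ m, fibreRestrict ζ' hC'.compl m (Metric.ball 0 (n + 1)) ∂P := by
    intro n
    have hb : MeasurableSet (Metric.ball (0 : X) (n + 1)) := Metric.isOpen_ball.measurableSet
    have e : ∀ (κ : Kernel M X) [IsSFiniteKernel κ] {C : Set (M × X)} (hC : MeasurableSet C),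
        ∫⁻ m, fibreRestrict κ hC m (Metric.ball 0 (n + 1)) ∂P +
          ∫⁻ m, fibreRestrict κ hC.compl m (Metric.ball 0 (n + 1)) ∂P =
        ∫⁻ m, κ m (Metric.ball 0 (n + 1)) ∂P := by
      intro κ _ C hC
      rw [← lintegral_add_left (Kernel.measurable_coe _ hb)]
      refine lintegral_congr fun m => ?_
      rw [fibreRestrict_apply, fibreRestrict_apply, preimage_compl, ← Measure.add_apply,
        Measure.restrict_add_restrict_compl (measurable_prodMk_left hC)]
    have e1 : ∫⁻ m, fibreRestrict ζ hC m (Metric.ball 0 (n + 1)) ∂P =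
        ∫⁻ m, fibreRestrict ζ' hC' m (Metric.ball 0 (n + 1)) ∂P := by
      rw [← lintegral_preimage_ball_eq hσ (hζ.fibreRestrict hC hCσ) hF hFσ (by positivity)]
      refine lintegral_congr_ae ?_
      filter_upwards [hmap] with m hm
      rw [fibreRestrict_apply, hm, fibreRestrict_apply]
    have e2 := (e ζ hC).trans ((hint n).trans (e ζ' hC').symm)
    rw [← e1] at e2
    refine (ENNReal.add_right_inj ?_).1 e2
    exact ((le_self_add.trans_eq (e ζ hC)).trans_lt (hfin n)).ne
  have hor : ∀ᵐ m ∂P, fibreRestrict ζ hC.compl m = 0 ∨ fibreRestrict ζ' hC'.compl m = 0 := by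
    filter_upwards [hD.nonempty, hat, hat'] with m hm _ _
    obtain ⟨y, hy⟩ := hm
    set b := β (m, y)
    have hb : b ∈ centres D β m := ⟨y, hy, rfl⟩
    have hcover : ⋃ i, Metric.ball (b + TopologicalSpace.denseSeq X i) ρ = univ := by
      refine eq_univ_of_forall fun x => ?_
      obtain ⟨i, hi⟩ := (TopologicalSpace.denseRange_denseSeq X).exists_dist_lt (x - b) hD.pos
      refine mem_iUnion.2 ⟨i, ?_⟩
      rw [Metric.mem_ball, dist_eq_norm] at *
      rwa [← sub_sub]
    by_contra! hne
    have key : ∀ μ : Measure X, μ ≠ 0 →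
        ∃ i, μ (Metric.ball (b + TopologicalSpace.denseSeq X i) ρ) ≠ 0 := by
      intro μ hμ
      by_contra! h
      refine hμ (Measure.measure_univ_eq_zero.1 ?_)
      rw [← hcover]
      exact measure_iUnion_null h
    obtain ⟨i, hi⟩ := key _ hne.1
    obtain ⟨j, hj⟩ := key _ hne.2
    rw [fibreRestrict_apply, Measure.restrict_apply Metric.isOpen_ball.measurableSet] at hi hj
    have hz : shift X (Nat.pair i j) = (TopologicalSpace.denseSeq X i,
      TopologicalSpace.denseSeq X j) := by simp [shift]
    have h := hD.measure_matched_compl ψ (shift X (Nat.pair i j)).1 (shift X (Nat.pair i j)).2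
      (A := A (Nat.pair i j)) (A' := B (Nat.pair i j)) (hζ.ball_lt_top m) (hζ'.ball_lt_top m) hb
    have hA0 : Cᶜ ⊆ A (Nat.pair i j) \ s (Nat.pair i j) :=
      compl_iUnion_subset_of_sdiff (A := A) rfl (fun n => rfl) (Nat.pair i j + 1)
    have hB0 : C'ᶜ ⊆ B (Nat.pair i j) \ t (Nat.pair i j) :=
      compl_iUnion_subset_of_sdiff (A := B) rfl (fun n => rfl) (Nat.pair i j + 1)
    rcases h with h | h
    · refine hi (measure_mono_null ?_ h)
      exact fun x hx => ⟨hA0 hx.2, by rw [hz]; exact hx.1⟩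
    · refine hj (measure_mono_null ?_ h)
      exact fun x hx => ⟨hB0 hx.2, by rw [hz]; exact hx.1⟩
  obtain ⟨h0, h0'⟩ := ae_eq_zero_of_or hσ (hζ.fibreRestrict hC.compl
    fun m x y => not_congr (hCσ m x y)) hint' hor
  have hful : ∀ᵐ m ∂P, (ζ m).restrict (Prod.mk m ⁻¹' C) = ζ m := by
    filter_upwards [h0] with m hm
    rw [fibreRestrict_apply, preimage_compl] at hm
    have := Measure.restrict_add_restrict_compl (μ := ζ m) (measurable_prodMk_left hC (x := m))
    rwa [hm, add_zero] at this
  have hful' : ∀ᵐ m ∂P, (ζ' m).restrict (Prod.mk m ⁻¹' C') = ζ' m := by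
    filter_upwards [h0'] with m hm
    rw [fibreRestrict_apply, preimage_compl] at hm
    have := Measure.restrict_add_restrict_compl (μ := ζ' m) (measurable_prodMk_left hC' (x := m))
    rwa [hm, add_zero] at this
  refine ⟨F, G, hF, hG, hFσ, hGσ, ?_, ?_, ?_⟩
  · filter_upwards [hful, hful', hmap] with m h1 h2 h3
    rwa [h1, h2] at h3
  · filter_upwards [hful, hful', hmap'] with m h1 h2 h3
    rwa [h1, h2] at h3
  · filter_upwards [hful, hinv] with m h1 h3
    rwa [h1] at h3

end Leftover

section LocallyFinite

open ProbabilityTheory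

/-- The space of measures which are finite on balls. -/
def BallFinite (E : Type*) [NormedAddCommGroup E] [MeasurableSpace E] : Type _ :=
  {μ : Measure E // ∀ n : ℕ, μ (Metric.ball 0 n) < ⊤}

variable {E : Type*} [NormedAddCommGroup E] [NormedSpace ℝ E] [FiniteDimensional ℝ E]
  [MeasurableSpace E] [BorelSpace E]

instance : MeasurableSpace (BallFinite E) := inferInstanceAs (MeasurableSpace (Subtype _))

namespace BallFinite

/-- The identity, as a kernel. -/
def kernel (E : Type*) [NormedAddCommGroup E] [MeasurableSpace E] : Kernel (BallFinite E) E where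
  toFun μ := μ.1
  measurable' := measurable_subtype_coe

lemma kernel_ball_lt_top (μ : BallFinite E) (r : ℝ) : kernel E μ (Metric.ball 0 r) < ⊤ :=
  (measure_mono (Metric.ball_subset_ball (Nat.le_ceil r))).trans_lt (μ.2 ⌈r⌉₊)

instance : IsSFiniteKernel (kernel E) := isSFiniteKernel_of_ball_lt_top _ kernel_ball_lt_top

lemma map_sub_ball_lt_top {μ : Measure E} (hμ : ∀ n : ℕ, μ (Metric.ball 0 n) < ⊤) (x : E) (n : ℕ) :
    μ.map (fun y => y - x) (Metric.ball 0 n) < ⊤ := by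
  rw [Measure.map_apply (measurable_sub_const x) Metric.isOpen_ball.measurableSet]
  refine (measure_mono ?_).trans_lt (kernel_ball_lt_top ⟨μ, hμ⟩ (n + ‖x‖))
  intro y hy
  simp only [mem_preimage, mem_ball_zero_iff] at *
  linarith [norm_le_norm_sub_add y x]

/-- The translation of measures. -/
def translate (x : E) (μ : BallFinite E) : BallFinite E :=
  ⟨μ.1.map fun y => y - x, map_sub_ball_lt_top μ.2 x⟩

lemma translate_val (x : E) (μ : BallFinite E) : (translate x μ).1 = μ.1.map fun y => y - x := rfl

lemma measurable_translate : Measurable fun q : E × BallFinite E => translate q.1 q.2 := by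
  refine Measurable.subtype_mk (Measure.measurable_of_measurable_coe _ fun s hs => ?_)
  have hS : MeasurableSet {p : (E × BallFinite E) × E | p.2 - p.1.1 ∈ s} :=
    (measurable_snd.sub (measurable_fst.comp measurable_fst)) hs
  convert Kernel.measurable_kernel_prodMk_left (κ := (kernel E).comap _ measurable_snd) hS using 2
    with q
  rw [Measure.map_apply (measurable_sub_const _) hs]
  rfl

lemma translate_zero (μ : BallFinite E) : translate 0 μ = μ :=
  Subtype.ext (by simp [translate_val])

lemma translate_add (x y : E) (μ : BallFinite E) :
    translate y (translate x μ) = translate (x + y) μ := by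
  refine Subtype.ext ?_
  rw [translate_val, translate_val, translate_val,
    Measure.map_map (measurable_sub_const y) (measurable_sub_const x)]
  congr 1
  ext z
  simp [sub_sub]

open Classical in
/-- A measurable retraction of the space of all measures. -/
def ofMeasure (μ : Measure E) : BallFinite E :=
  if h : ∀ n : ℕ, μ (Metric.ball 0 n) < ⊤ then ⟨μ, h⟩ else ⟨0, by simp⟩

lemma ofMeasure_of {μ : Measure E} (h : ∀ n : ℕ, μ (Metric.ball 0 n) < ⊤) :
    ofMeasure μ = ⟨μ, h⟩ :=
  dif_pos h

lemma ofMeasure_of_not {μ : Measure E} (h : ¬ ∀ n : ℕ, μ (Metric.ball 0 n) < ⊤) :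
    ofMeasure μ = ⟨0, by simp⟩ :=
  dif_neg h

lemma ofMeasure_val {μ : Measure E} (h : ∀ n : ℕ, μ (Metric.ball 0 n) < ⊤) :
    (ofMeasure μ).1 = μ := by
  rw [ofMeasure_of h]

open Classical in
lemma measurable_ofMeasure : Measurable (ofMeasure : Measure E → BallFinite E) := by
  have hs : MeasurableSet {μ : Measure E | ∀ n : ℕ, μ (Metric.ball 0 n) < ⊤} := by
    rw [ofPred_forall]
    exact MeasurableSet.iInter fun n => measurableSet_lt
      (Measure.measurable_coe Metric.isOpen_ball.measurableSet) measurable_const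
  have h : Measurable fun μ : Measure E => (ofMeasure μ).1 := by
    have heq : (fun μ : Measure E => (ofMeasure μ).1) =
        fun μ => if ∀ n : ℕ, μ (Metric.ball 0 n) < ⊤ then μ else 0 := by
      funext μ
      split_ifs with hμ
      · rw [ofMeasure_val hμ]
      · rw [ofMeasure_of_not hμ]
    rw [heq]
    exact Measurable.ite hs measurable_id measurable_const
  exact h.subtype_mk

lemma ofMeasure_map_sub (μ : Measure E) (x : E) :
    ofMeasure (μ.map fun y => y - x) = translate x (ofMeasure μ) := by
  by_cases h : ∀ n : ℕ, μ (Metric.ball 0 n) < ⊤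
  · rw [ofMeasure_of h, ofMeasure_of (map_sub_ball_lt_top h x)]
    rfl
  · have h' : ¬ ∀ n : ℕ, (μ.map fun y => y - x) (Metric.ball 0 n) < ⊤ := by
      refine fun h' => h ?_
      have := map_sub_ball_lt_top h' (-x)
      rw [Measure.map_map (measurable_sub_const _) (measurable_sub_const x)] at this
      have hid : ((fun y : E => y - -x) ∘ fun y => y - x) = id := by
        ext y
        simp
      rwa [hid, Measure.map_id] at this
    rw [ofMeasure_of_not h, ofMeasure_of_not h']
    exact Subtype.ext (Measure.map_zero _).symm

/-- The intersection of a ball with finitely many sets from a countable basis of the topology. -/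
def basicSet (i : Finset (TopologicalSpace.countableBasis E) × ℕ) : Set E :=
  (⋂ u ∈ i.1, (u : Set E)) ∩ Metric.ball 0 i.2

lemma isOpen_basicSet (i : Finset (TopologicalSpace.countableBasis E) × ℕ) :
    IsOpen (basicSet i) :=
  (isOpen_biInter_finset fun u _ => TopologicalSpace.isOpen_of_mem_countableBasis u.2).inter
    Metric.isOpen_ball

lemma ext_of_basicSet {μ ν : BallFinite E} (h : ∀ i, μ.1 (basicSet i) = ν.1 (basicSet i)) :
    μ = ν := by
  classical
  refine Subtype.ext (Measure.ext_of_generateFrom_of_iUnion (range basicSet)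
    (fun n : ℕ => Metric.ball 0 n) ?_ ?_ (Metric.iUnion_ball_nat 0) ?_ (fun n => (μ.2 n).ne) ?_)
  · refine le_antisymm ?_ (MeasurableSpace.generateFrom_le ?_)
    · rw [BorelSpace.measurable_eq (α := E),
        (TopologicalSpace.isBasis_countableBasis E).borel_eq_generateFrom]
      refine MeasurableSpace.generateFrom_le fun u hu => ?_
      have : u = ⋃ n : ℕ, basicSet ({⟨u, hu⟩}, n) := by
        simp only [basicSet, Finset.mem_singleton, iInter_iInter_eq_left]
        rw [← inter_iUnion, Metric.iUnion_ball_nat, inter_univ]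
      rw [this]
      exact MeasurableSet.iUnion fun n => MeasurableSpace.measurableSet_generateFrom ⟨_, rfl⟩
    · rintro _ ⟨i, rfl⟩
      exact (isOpen_basicSet i).measurableSet
  · rintro _ ⟨i, rfl⟩ _ ⟨j, rfl⟩ -
    refine ⟨(i.1 ∪ j.1, min i.2 j.2), ?_⟩
    ext y
    simp only [basicSet, mem_inter_iff, mem_iInter, Finset.mem_union, mem_ball_zero_iff,
      Nat.cast_min, lt_min_iff]
    constructor
    · exact fun h => ⟨⟨fun u hu => h.1 u (Or.inl hu), h.2.1⟩, fun u hu => h.1 u (Or.inr hu), h.2.2⟩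
    · exact fun h => ⟨fun u hu => hu.elim (h.1.1 u) (h.2.1 u), h.1.2, h.2.2⟩
  · exact fun n => ⟨(∅, n), by simp [basicSet]⟩
  · rintro _ ⟨i, rfl⟩
    exact h i

/-- Continuous approximations of the indicator function of `U` from below. -/
def bump (U : Set E) (k : ℕ) (y : E) : ENNReal := min 1 (k * Metric.infEDist y Uᶜ)

lemma continuous_bump (U : Set E) (k : ℕ) : Continuous (bump U k) :=
  continuous_const.min ((ENNReal.continuous_const_mul (ENNReal.natCast_ne_top k)).comp
    Metric.continuous_infEDist)

lemma bump_le_indicator (U : Set E) (k : ℕ) (y : E) : bump U k y ≤ U.indicator 1 y := by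
  by_cases hy : y ∈ U
  · rw [indicator_of_mem hy]
    exact min_le_left _ _
  · rw [indicator_of_notMem hy, bump, Metric.infEDist_zero_of_mem (show y ∈ Uᶜ from hy)]
    simp

lemma tendsto_lintegral_bump (μ : Measure E) {U : Set E} (hU : IsOpen U) :
    Tendsto (fun k : ℕ => ∫⁻ y, bump U k y ∂μ) atTop (nhds (μ U)) := by
  rw [← lintegral_indicator_one hU.measurableSet]
  refine lintegral_tendsto_of_tendsto_of_monotone
    (fun k => (continuous_bump U k).measurable.aemeasurable) (ae_of_all _ fun y => ?_)
    (ae_of_all _ fun y => ?_)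
  · intro k l hkl
    exact min_le_min le_rfl (mul_le_mul_left (Nat.cast_le.2 hkl) _)
  · by_cases hy : y ∈ U
    · have h0 : Metric.infEDist y Uᶜ ≠ 0 := fun h =>
        (Metric.mem_iff_infEDist_zero_of_closed hU.isClosed_compl).2 h hy
      obtain ⟨k, hk⟩ := ENNReal.exists_nat_mul_gt h0 ENNReal.one_ne_top
      rw [indicator_of_mem hy]
      refine tendsto_const_nhds.congr' ?_
      filter_upwards [eventually_ge_atTop k] with l hl
      exact (min_eq_left (hk.le.trans (mul_le_mul_left (Nat.cast_le.2 hl) _))).symm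
    · have : ∀ k : ℕ, bump U k y = 0 := fun k =>
        le_antisymm ((bump_le_indicator U k y).trans_eq (indicator_of_notMem hy _)) zero_le
      simp [this, hy]

/-- The functions which separate the measures. -/
def test (i : (Finset (TopologicalSpace.countableBasis E) × ℕ) × ℕ) (μ : BallFinite E) : ℝ :=
  (∫⁻ y, bump (basicSet i.1) i.2 y ∂μ.1).toReal

lemma lintegral_bump_lt_top (i : Finset (TopologicalSpace.countableBasis E) × ℕ) (k : ℕ)
    (μ : BallFinite E) : ∫⁻ y, bump (basicSet i) k y ∂μ.1 < ⊤ := by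
  refine (lintegral_mono (bump_le_indicator _ k)).trans_lt ?_
  rw [lintegral_indicator_one (isOpen_basicSet i).measurableSet]
  exact (measure_mono inter_subset_right).trans_lt (μ.2 i.2)

lemma measurable_test (i : (Finset (TopologicalSpace.countableBasis E) × ℕ) × ℕ) :
    Measurable (test i : BallFinite E → ℝ) :=
  ((Measure.measurable_lintegral (continuous_bump _ _).measurable).comp
    measurable_subtype_coe).ennreal_toReal

lemma eq_of_test {μ ν : BallFinite E} (h : ∀ i, test i μ = test i ν) : μ = ν := by
  refine ext_of_basicSet fun i => tendsto_nhds_unique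
    (tendsto_lintegral_bump μ.1 (isOpen_basicSet i)) ?_
  refine (tendsto_lintegral_bump ν.1 (isOpen_basicSet i)).congr fun k => ?_
  exact ((ENNReal.toReal_eq_toReal_iff' (lintegral_bump_lt_top i k μ).ne
    (lintegral_bump_lt_top i k ν).ne).1 (h (i, k))).symm

lemma continuous_test (i : (Finset (TopologicalSpace.countableBasis E) × ℕ) × ℕ)
    (μ : BallFinite E) : Continuous fun x => test i (translate x μ) := by
  have h : ∀ x, ∫⁻ y, bump (basicSet i.1) i.2 y ∂(translate x μ).1 =
      ∫⁻ y, bump (basicSet i.1) i.2 (y - x) ∂μ.1 := fun x => by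
    rw [translate_val, lintegral_map (continuous_bump _ _).measurable (measurable_sub_const x)]
  refine continuous_iff_continuousAt.2 fun x₀ => ?_
  refine (ENNReal.tendsto_toReal (lintegral_bump_lt_top i.1 i.2 (translate x₀ μ)).ne).comp ?_
  simp only [h]
  refine tendsto_lintegral_filter_of_dominated_convergence
    ((Metric.ball 0 (i.1.2 + ‖x₀‖ + 1)).indicator 1) (Eventually.of_forall fun x =>
    (continuous_bump _ _).measurable.comp (measurable_sub_const x)) ?_ ?_ (ae_of_all _ fun y => ?_)
  · filter_upwards [Metric.ball_mem_nhds x₀ one_pos] with x hx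
    refine ae_of_all _ fun y => (bump_le_indicator _ _ _).trans ?_
    by_cases hy : y - x ∈ basicSet i.1
    · rw [indicator_of_mem hy, indicator_of_mem]
      · rfl
      · have h1 := mem_ball_zero_iff.1 hy.2
        rw [mem_ball_iff_norm] at hx
        rw [mem_ball_zero_iff]
        linarith [norm_le_norm_sub_add y x, norm_le_norm_sub_add x x₀]
    · rw [indicator_of_notMem hy]
      exact zero_le
  · rw [lintegral_indicator_one Metric.isOpen_ball.measurableSet]
    exact (kernel_ball_lt_top μ _).ne
  · exact ((continuous_bump _ _).tendsto _).comp
      ((continuous_const.sub continuous_id).tendsto x₀)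

end BallFinite

/-- The diagonal translation of pairs of measures. -/
def pairFlow (x : E) (m : BallFinite E × BallFinite E) : BallFinite E × BallFinite E :=
  (m.1.translate x, m.2.translate x)

lemma measurable_pairFlow :
    Measurable fun q : E × (BallFinite E × BallFinite E) => pairFlow q.1 q.2 :=
  (BallFinite.measurable_translate.comp
    (measurable_fst.prodMk (measurable_fst.comp measurable_snd))).prodMk
  (BallFinite.measurable_translate.comp
    (measurable_fst.prodMk (measurable_snd.comp measurable_snd)))

lemma exists_separatesOrbits_pairFlow :
    ∃ f, SeparatesOrbits (pairFlow : E → BallFinite E × BallFinite E → _) f := by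
  obtain ⟨e, he⟩ := exists_surjective_nat
    ((Finset (TopologicalSpace.countableBasis E) × ℕ) × ℕ ⊕
      (Finset (TopologicalSpace.countableBasis E) × ℕ) × ℕ)
  refine ⟨fun j m => (e j).elim (fun i => BallFinite.test i m.1) fun i => BallFinite.test i m.2,
    ?_, ?_, ?_⟩
  · intro j
    rcases e j with i | i
    · exact (BallFinite.measurable_test i).comp measurable_fst
    · exact (BallFinite.measurable_test i).comp measurable_snd
  · intro j m
    rcases e j with i | i
    · exact BallFinite.continuous_test i m.1
    · exact BallFinite.continuous_test i m.2
  · intro m m' h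
    refine Prod.ext (BallFinite.eq_of_test fun i => ?_) (BallFinite.eq_of_test fun i => ?_)
    · obtain ⟨j, hj⟩ := he (Sum.inl i)
      simpa [hj] using h j
    · obtain ⟨j, hj⟩ := he (Sum.inr i)
      simpa [hj] using h j

end LocallyFinite

section Slice

open ProbabilityTheory TopologicalSpace

variable {E V L M : Type*} [NormedAddCommGroup E] [NormedSpace ℝ E] [FiniteDimensional ℝ E]
  [MeasurableSpace E] [BorelSpace E] [NormedAddCommGroup V] [NormedSpace ℝ V]
  [FiniteDimensional ℝ V] [MeasurableSpace V] [BorelSpace V] [NormedAddCommGroup L]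
  [NormedSpace ℝ L] [FiniteDimensional ℝ L] [MeasurableSpace L] [BorelSpace L]
  [MeasurableSpace M] {σ : E → M → M} {P : Measure M} {ζ ζ' : Kernel M E}

lemma measurable_fst_equiv (e : E ≃L[ℝ] V × L) : Measurable fun y => (e y).1 :=
  (continuous_fst.comp e.continuous).measurable

lemma measurable_snd_equiv (e : E ≃L[ℝ] V × L) : Measurable fun y => (e y).2 :=
  (continuous_snd.comp e.continuous).measurable

lemma measurableSet_slab (e : E ≃L[ℝ] V × L) (K : PositiveCompacts L) :
    MeasurableSet {y | (e y).2 ∈ (K : Set L)} :=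
  measurable_snd_equiv e K.isCompact.measurableSet

lemma measurableSet_box (e : E ≃L[ℝ] V × L) {A : Set V} {B : Set L} (hA : MeasurableSet A)
    (hB : MeasurableSet B) : MeasurableSet {y | (e y).1 ∈ A ∧ (e y).2 ∈ B} :=
  (measurable_fst_equiv e hA).inter (measurable_snd_equiv e hB)

/-- The projection to `V` of the restriction of a kernel to the slab over `K`. -/
def slice (e : E ≃L[ℝ] V × L) (K : PositiveCompacts L) (ζ : Kernel M E) : Kernel M V :=
  (ζ.restrict (measurableSet_slab e K)).map fun y => (e y).1

lemma slice_apply (e : E ≃L[ℝ] V × L) (K : PositiveCompacts L) (ζ : Kernel M E) (m : M)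
    {A : Set V} (hA : MeasurableSet A) :
    slice e K ζ m A = ζ m {y | (e y).1 ∈ A ∧ (e y).2 ∈ (K : Set L)} := by
  rw [slice, Kernel.map_apply' _ (measurable_fst_equiv e) _ hA, Kernel.restrict_apply',
    inter_comm]
  · congr 1
    ext y
    exact and_comm
  · exact measurable_fst_equiv e hA

lemma isBounded_slab (e : E ≃L[ℝ] V × L) {A : Set V} {B : Set L} (hA : Bornology.IsBounded A)
    (hB : Bornology.IsBounded B) : Bornology.IsBounded {y | (e y).1 ∈ A ∧ (e y).2 ∈ B} := by
  refine (e.symm.lipschitz.isBounded_image (hA.prod hB)).subset fun y hy => ?_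
  exact ⟨e y, hy, e.symm_apply_apply y⟩

lemma IsEquivariantKernel.lt_top_of_isBounded (hζ : IsEquivariantKernel σ ζ) (m : M) {A : Set E}
    (hA : Bornology.IsBounded A) : ζ m A < ⊤ := by
  obtain ⟨r, hr⟩ := hA.subset_ball 0
  exact (measure_mono hr).trans_lt (hζ.ball_lt_top m r)

lemma IsEquivariantKernel.slice (hζ : IsEquivariantKernel σ ζ) (e : E ≃L[ℝ] V × L)
    (K : PositiveCompacts L) :
    IsEquivariantKernel (fun v => σ (e.symm (v, 0))) (slice e K ζ) where
  ball_lt_top m r := by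
    rw [slice_apply _ _ _ _ Metric.isOpen_ball.measurableSet]
    exact hζ.lt_top_of_isBounded m (isBounded_slab e Metric.isBounded_ball K.isCompact.isBounded)
  apply_flow v m := by
    ext A hA
    rw [Measure.map_apply (measurable_sub_const v) hA, slice_apply _ _ _ _ hA,
      slice_apply _ _ _ _ (measurable_sub_const v hA), hζ.apply_flow, Measure.map_apply
      (measurable_sub_const _) (measurableSet_box e hA K.isCompact.measurableSet)]
    congr 1
    ext y
    simp

/-- A measure which is invariant under the translations of the second factor is a product. -/
lemma map_equiv_eq_prod (hζ : IsEquivariantKernel σ ζ) (e : E ≃L[ℝ] V × L)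
    (K : PositiveCompacts L) {m : M} (hm : ∀ l, σ (e.symm (0, l)) m = m) :
    (ζ m).map e = (slice e K ζ m).prod (Measure.addHaarMeasure K) := by
  have hslice := hζ.slice e K
  have hem : Measurable e := e.continuous.measurable
  have hbdd : ∀ A : Set V, MeasurableSet A → Bornology.IsBounded A → ∀ B : Set L,
      MeasurableSet B →
      (ζ m).map e (A ×ˢ B) = slice e K ζ m A * Measure.addHaarMeasure K B := by
    intro A hA hAb B hB
    set ν : Measure L := ((ζ m).restrict {y | (e y).1 ∈ A}).map fun y => (e y).2 with hν
    have hνapp : ∀ B : Set L, MeasurableSet B → ν B = ζ m {y | (e y).1 ∈ A ∧ (e y).2 ∈ B} := by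
      intro B hB
      rw [hν, Measure.map_apply (measurable_snd_equiv e) hB,
        Measure.restrict_apply (measurable_snd_equiv e hB), inter_comm]
      rfl
    have hνinv : ν.IsAddLeftInvariant := by
      refine ⟨fun l => ?_⟩
      ext B hB
      rw [Measure.map_apply (measurable_const_add l) hB, hνapp _ hB,
        hνapp _ (measurable_const_add l hB)]
      conv_rhs => rw [← hm (-l), hζ.apply_flow, Measure.map_apply (measurable_sub_const _)
        (measurableSet_box e hA hB)]
      congr 1
      ext y
      simp [add_comm]
    have hνfin : IsFiniteMeasureOnCompacts ν := by
      refine ⟨fun C hC => ?_⟩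
      rw [hνapp _ hC.measurableSet]
      exact hζ.lt_top_of_isBounded m (isBounded_slab e hAb hC.isBounded)
    have h := Measure.addHaarMeasure_unique ν K
    have h1 : ν B = ν K * Measure.addHaarMeasure K B := by
      conv_lhs => rw [h]
      simp
    rw [slice_apply _ _ _ _ hA, ← hνapp _ K.isCompact.measurableSet, ← h1, hνapp _ hB,
      Measure.map_apply hem (hA.prod hB)]
    rfl
  have hσf : SigmaFinite (slice e K ζ m) := by
    have : IsFiniteMeasureOnCompacts (slice e K ζ m) :=
      ⟨fun C hC => hslice.lt_top_of_isBounded m hC.isBounded⟩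
    infer_instance
  refine (Measure.prod_eq fun A B hA hB => ?_).symm
  have hmono : Monotone fun n : ℕ => A ∩ Metric.ball 0 n := fun n k hnk =>
    inter_subset_inter_right _ (Metric.ball_subset_ball (Nat.cast_le.2 hnk))
  have hUn : A = ⋃ n : ℕ, A ∩ Metric.ball 0 n := by
    rw [← inter_iUnion, Metric.iUnion_ball_nat, inter_univ]
  have hUn' : A ×ˢ B = ⋃ n : ℕ, (A ∩ Metric.ball 0 n) ×ˢ B := by
    rw [← iUnion_prod_const, ← hUn]
  rw [hUn', Monotone.measure_iUnion fun n k hnk => prod_mono (hmono hnk) subset_rfl]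
  conv_rhs => rw [hUn, hmono.measure_iUnion, ENNReal.iSup_mul]
  exact iSup_congr fun n => hbdd _ (hA.inter Metric.isOpen_ball.measurableSet)
    (Metric.isBounded_ball.subset inter_subset_right) B hB

lemma IsErgodicFlow.comp_equiv (hσ : IsErgodicFlow σ P) (e : E ≃L[ℝ] V × L) {N : Set M}
    (hN : MeasurableSet N) (hNP : ∀ᵐ m ∂P, m ∈ N) (hNσ : ∀ x, σ x ⁻¹' N = N)
    (hNL : ∀ m ∈ N, ∀ l, σ (e.symm (0, l)) m = m) :
    IsErgodicFlow (fun v => σ (e.symm (v, 0))) P where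
  measurable := hσ.measurable.comp (((e.symm.continuous.comp
    (Continuous.prodMk_left 0)).measurable.comp measurable_fst).prodMk measurable_snd)
  zero m := by
    have : ((0, 0) : V × L) = 0 := rfl
    simp only [this, map_zero, hσ.zero]
  add v w m := by
    rw [hσ.add, ← map_add]
    simp
  preserving v := hσ.preserving _
  zero_one A hA hinv := by
    have hAN : P (A ∩ N) = P A := measure_congr (by
      filter_upwards [hNP] with m hm
      exact propext (and_iff_left hm))
    rw [← hAN]
    refine hσ.zero_one _ (hA.inter hN) fun x => ?_
    rw [preimage_inter, hNσ]
    ext m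
    refine and_congr_left fun hm => ?_
    have hx : x = e.symm (0, (e x).2) + e.symm ((e x).1, 0) := by
      rw [← map_add]
      simp
    rw [mem_preimage, hx, ← hσ.add, hNL m hm]
    exact Set.ext_iff.1 (hinv (e x).1) m

open Classical in
/-- The extension to `V × L` of an allocation on `V`. -/
def extendAlloc (e : E ≃L[ℝ] V × L) (N : Set M) (F : M × V → V) (q : M × E) : E :=
  if q.1 ∈ N then e.symm (F (q.1, (e q.2).1), (e q.2).2) else q.2

lemma extendAlloc_of_mem (e : E ≃L[ℝ] V × L) {N : Set M} (F : M × V → V) {m : M} (hm : m ∈ N)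
    (y : E) : extendAlloc e N F (m, y) = e.symm (F (m, (e y).1), (e y).2) :=
  if_pos hm

lemma extendAlloc_of_notMem (e : E ≃L[ℝ] V × L) {N : Set M} (F : M × V → V) {m : M} (hm : m ∉ N)
    (y : E) : extendAlloc e N F (m, y) = y :=
  if_neg hm

lemma measurable_extendAlloc (e : E ≃L[ℝ] V × L) {N : Set M} (hN : MeasurableSet N)
    {F : M × V → V} (hF : Measurable F) : Measurable (extendAlloc e N F) :=
  Measurable.ite (measurable_fst hN) (e.symm.continuous.measurable.comp
    ((hF.comp (measurable_fst.prodMk ((measurable_fst_equiv e).comp measurable_snd))).prodMk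
      ((measurable_snd_equiv e).comp measurable_snd))) measurable_snd

lemma isEquivariantMap_extendAlloc (hσ : IsErgodicFlow σ P) (e : E ≃L[ℝ] V × L) {N : Set M}
    (hNσ : ∀ x, σ x ⁻¹' N = N) (hNL : ∀ m ∈ N, ∀ l, σ (e.symm (0, l)) m = m) {F : M × V → V}
    (hF : IsEquivariantMap (fun v => σ (e.symm (v, 0))) F) :
    IsEquivariantMap σ (extendAlloc e N F) := by
  intro m x y
  have hiff : σ x m ∈ N ↔ m ∈ N := Set.ext_iff.1 (hNσ x) m
  by_cases hm : m ∈ N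
  · rw [extendAlloc_of_mem e F (hiff.2 hm), extendAlloc_of_mem e F hm]
    have hx : x = e.symm (0, (e x).2) + e.symm ((e x).1, 0) := by
      rw [← map_add]
      simp
    have hflow : σ x m = σ (e.symm ((e x).1, 0)) m := by
      conv_lhs => rw [hx, ← hσ.add, hNL m hm]
    rw [hflow, hF]
    apply e.injective
    refine Prod.ext ?_ ?_ <;> simp
  · rw [extendAlloc_of_notMem e F (fun h => hm (hiff.1 h)), extendAlloc_of_notMem e F hm]
    simp

lemma map_extendAlloc (hζ : IsEquivariantKernel σ ζ) (hζ' : IsEquivariantKernel σ ζ')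
    (e : E ≃L[ℝ] V × L) (K : PositiveCompacts L) {N : Set M} {m : M} (hmN : m ∈ N)
    (hm : ∀ l, σ (e.symm (0, l)) m = m) {F : M × V → V} (hF : Measurable F)
    (h : (slice e K ζ m).map (fun v => F (m, v)) = slice e K ζ' m) :
    (ζ m).map (fun y => extendAlloc e N F (m, y)) = ζ' m := by
  have := (hζ.slice e K).isSFiniteKernel
  have hem : Measurable e := e.continuous.measurable
  have hsm : Measurable e.symm := e.symm.continuous.measurable
  have hFm : Measurable fun v => F (m, v) := hF.comp measurable_prodMk_left
  have heq : (fun y => extendAlloc e N F (m, y)) =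
      e.symm ∘ Prod.map (fun v => F (m, v)) id ∘ e := by
    funext y
    exact extendAlloc_of_mem e F hmN y
  rw [heq, ← Measure.map_map hsm ((hFm.prodMap measurable_id).comp hem),
    ← Measure.map_map (hFm.prodMap measurable_id) hem, map_equiv_eq_prod hζ e K hm,
    ← Measure.map_prod_map _ _ hFm measurable_id, h, Measure.map_id,
    ← map_equiv_eq_prod hζ' e K hm, Measure.map_map hsm hem]
  simp

lemma extendAlloc_extendAlloc (hζ : IsEquivariantKernel σ ζ)
    (e : E ≃L[ℝ] V × L) (K : PositiveCompacts L) {N : Set M} {m : M} (hmN : m ∈ N)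
    (hm : ∀ l, σ (e.symm (0, l)) m = m) {F G : M × V → V}
    (h : ∀ᵐ v ∂(slice e K ζ m), G (m, F (m, v)) = v) :
    ∀ᵐ y ∂(ζ m), extendAlloc e N G (m, extendAlloc e N F (m, y)) = y := by
  have h2 : ∀ᵐ z ∂(ζ m).map e, G (m, F (m, z.1)) = z.1 := by
    rw [map_equiv_eq_prod hζ e K hm]
    exact Measure.quasiMeasurePreserving_fst.ae h
  filter_upwards [ae_of_ae_map e.continuous.measurable.aemeasurable h2] with y hy
  rw [extendAlloc_of_mem e F hmN, extendAlloc_of_mem e G hmN]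
  apply e.injective
  simp [hy]

/-- The matching of two kernels whose slices are atomless and of the same intensity. -/
lemma exists_matching_of_slice [Nontrivial V] [IsProbabilityMeasure P] (hσ : IsErgodicFlow σ P)
    (e : E ≃L[ℝ] V × L) (K : PositiveCompacts L) {N : Set M}
    (hN : MeasurableSet N) (hNP : ∀ᵐ m ∂P, m ∈ N) (hNσ : ∀ x, σ x ⁻¹' N = N)
    (hNL : ∀ m ∈ N, ∀ l, σ (e.symm (0, l)) m = m) {ρ : ℝ} {D : Set (M × V)} {β : M × V → V}
    (hD : IsBallFamily (fun v => σ (e.symm (v, 0))) P ρ D β)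
    (hζ : IsEquivariantKernel σ ζ) (hζ' : IsEquivariantKernel σ ζ')
    (hint : ∀ A : Set E, MeasurableSet A → Bornology.IsBounded A →
      ∫⁻ m, ζ m A ∂P = ∫⁻ m, ζ' m A ∂P)
    (hfin : ∀ A : Set E, MeasurableSet A → Bornology.IsBounded A → ∫⁻ m, ζ m A ∂P < ⊤)
    (hat : ∀ᵐ m ∂P, NullSingletonClass (slice e K ζ m))
    (hat' : ∀ᵐ m ∂P, NullSingletonClass (slice e K ζ' m)) :
    ∃ F G : M × E → E, Measurable F ∧ Measurable G ∧ IsEquivariantMap σ F ∧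
      IsEquivariantMap σ G ∧
      (∀ᵐ m ∂P, (ζ m).map (fun x => F (m, x)) = ζ' m) ∧
      (∀ᵐ m ∂P, (ζ' m).map (fun x => G (m, x)) = ζ m) ∧
      ∀ᵐ m ∂P, ∀ᵐ x ∂(ζ m), G (m, F (m, x)) = x := by
  have hbox : ∀ n : ℕ, MeasurableSet
      {y | (e y).1 ∈ Metric.ball (0 : V) (n + 1) ∧ (e y).2 ∈ (K : Set L)} := fun n =>
    measurableSet_box e Metric.isOpen_ball.measurableSet K.isCompact.measurableSet
  have hbox' : ∀ n : ℕ, Bornology.IsBounded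
      {y | (e y).1 ∈ Metric.ball (0 : V) (n + 1) ∧ (e y).2 ∈ (K : Set L)} := fun n =>
    isBounded_slab e Metric.isBounded_ball K.isCompact.isBounded
  obtain ⟨F, G, hF, hG, hFe, hGe, hFm, hGm, hGF⟩ := exists_matching
    (hσ.comp_equiv e hN hNP hNσ hNL) hD (hζ.slice e K) (hζ'.slice e K)
    (fun n => by
      simp only [slice_apply _ _ _ _ Metric.isOpen_ball.measurableSet]
      exact hint _ (hbox n) (hbox' n))
    (fun n => by
      simp only [slice_apply _ _ _ _ Metric.isOpen_ball.measurableSet]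
      exact hfin _ (hbox n) (hbox' n)) hat hat'
  refine ⟨extendAlloc e N F, extendAlloc e N G, measurable_extendAlloc e hN hF,
    measurable_extendAlloc e hN hG, isEquivariantMap_extendAlloc hσ e hNσ hNL hFe,
    isEquivariantMap_extendAlloc hσ e hNσ hNL hGe, ?_, ?_, ?_⟩
  · filter_upwards [hNP, hFm] with m hm h
    exact map_extendAlloc hζ hζ' e K hm (hNL m hm) hF h
  · filter_upwards [hNP, hGm] with m hm h
    exact map_extendAlloc hζ' hζ e K hm (hNL m hm) hG h
  · filter_upwards [hNP, hGF] with m hm h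
    exact extendAlloc_extendAlloc hζ e K hm (hNL m hm) h

end Slice

section Invariance

open ProbabilityTheory TopologicalSpace

variable {E M : Type*} [NormedAddCommGroup E] [NormedSpace ℝ E] [FiniteDimensional ℝ E]
  [MeasurableSpace E] [BorelSpace E]
  [MeasurableSpace M] {σ : E → M → M} {P : Measure M} {ζ ζ' : Kernel M E} {f : ℕ → M → ℝ}

/-- The directions along which almost every point is fixed by the flow. -/
def IsErgodicFlow.invariantSubmodule (hσ : IsErgodicFlow σ P) : Submodule ℝ E where
  carrier := {x | ∀ᵐ m ∂P, ∀ t : ℝ, σ (t • x) m = m}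
  zero_mem' := by simp [hσ.zero]
  add_mem' {x y} hx hy := by
    change ∀ᵐ m ∂P, ∀ t : ℝ, σ (t • (x + y)) m = m
    filter_upwards [hx, hy] with m hx hy t
    rw [smul_add, ← hσ.add, hx, hy]
  smul_mem' c x hx := by
    change ∀ᵐ m ∂P, ∀ t : ℝ, σ (t • c • x) m = m
    filter_upwards [hx] with m hx t
    rw [smul_smul, hx]

/-- The points which are fixed by the translations from a subspace. -/
def fixedByAll (σ : E → M → M) (L : Submodule ℝ E) : Set M := {m | ∀ x ∈ L, σ x m = m}

lemma SeparatesOrbits.fixed_of_dense (hf : SeparatesOrbits σ f) {L : Submodule ℝ E} {m : M}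
    (h : ∀ n, σ (denseSeq L n : E) m = m) : m ∈ fixedByAll σ L := by
  intro x hx
  refine hf.separates _ _ fun j => ?_
  have hcl : IsClosed {y : L | f j (σ (y : E) m) = f j m} :=
    isClosed_eq ((hf.continuous j m).comp continuous_subtype_val) continuous_const
  have : range (denseSeq L) ⊆ {y : L | f j (σ (y : E) m) = f j m} := by
    rintro _ ⟨n, rfl⟩
    exact congrArg (f j) (h n)
  exact (hcl.closure_subset_iff.2 this) (denseRange_denseSeq L ⟨x, hx⟩)

lemma measurableSet_fixedByAll (hσ : IsErgodicFlow σ P) (hf : SeparatesOrbits σ f)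
    (L : Submodule ℝ E) : MeasurableSet (fixedByAll σ L) := by
  have : fixedByAll σ L = ⋂ n, ⋂ j, {m | f j (σ (denseSeq L n : E) m) = f j m} := by
    ext m
    simp only [mem_iInter, mem_ofPred_eq]
    refine ⟨fun h n j => congrArg (f j) (h _ (denseSeq L n).2), fun h => ?_⟩
    exact hf.fixed_of_dense fun n => hf.separates _ _ (h n)
  rw [this]
  exact MeasurableSet.iInter fun n => MeasurableSet.iInter fun j => measurableSet_eq_fun
    ((hf.measurable j).comp (hσ.measurable_apply _)) (hf.measurable j)

lemma ae_mem_fixedByAll (hσ : IsErgodicFlow σ P) (hf : SeparatesOrbits σ f) :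
    ∀ᵐ m ∂P, m ∈ fixedByAll σ hσ.invariantSubmodule := by
  have : ∀ᵐ m ∂P, ∀ n, σ (denseSeq hσ.invariantSubmodule n : E) m = m := by
    rw [ae_all_iff]
    intro n
    filter_upwards [(denseSeq hσ.invariantSubmodule n).2] with m hm
    simpa using hm 1
  filter_upwards [this] with m hm
  exact hf.fixed_of_dense hm

lemma preimage_fixedByAll (hσ : IsErgodicFlow σ P) (L : Submodule ℝ E) (x : E) :
    σ x ⁻¹' fixedByAll σ L = fixedByAll σ L := by
  ext m
  refine forall₂_congr fun y _ => ?_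
  rw [hσ.add, add_comm, ← hσ.add]
  refine ⟨fun h => ?_, fun h => by rw [h]⟩
  have := congrArg (σ (-x)) h
  simpa [hσ.add, hσ.zero] using this

lemma IsEquivariantKernel.eq_zero_or_eq_zero (hζ : IsEquivariantKernel σ ζ)
    (hζ' : IsEquivariantKernel σ ζ') {m : M} (hm : ∀ x, σ x m = m)
    (hs : Measure.MutuallySingular (ζ m) (ζ' m)) : ζ m = 0 ∨ ζ' m = 0 := by
  obtain ⟨K⟩ : Nonempty (PositiveCompacts E) := inferInstance
  have hHaar : ∀ {κ : Kernel M E}, IsEquivariantKernel σ κ →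
      κ m = κ m K • Measure.addHaarMeasure K := by
    intro κ hκ
    have hfin : IsFiniteMeasureOnCompacts (κ m) :=
      ⟨fun C hC => hκ.lt_top_of_isBounded m hC.isBounded⟩
    have hinv : (κ m).IsAddLeftInvariant := by
      refine ⟨fun x => ?_⟩
      conv_rhs => rw [← hm (-x), hκ.apply_flow]
      congr 1
      ext y
      simp [add_comm]
    exact Measure.addHaarMeasure_unique _ K
  have h := hHaar hζ
  have h' := hHaar hζ'
  rw [h, h'] at hs
  by_contra! hne
  have h1 : ζ m K ≠ 0 := fun h0 => hne.1 (by rw [h, h0, zero_smul])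
  have h2 : ζ' m K ≠ 0 := fun h0 => hne.2 (by rw [h', h0, zero_smul])
  have hself := hs.mono_ac (Measure.absolutelyContinuous_smul h1)
    (Measure.absolutelyContinuous_smul h2)
  rw [Measure.MutuallySingular.self_iff] at hself
  exact hne.1 (by rw [h, hself, smul_zero])

lemma measurableSet_eq_zero_or_eq_zero (ζ ζ' : Kernel M E) :
    MeasurableSet {m | ζ m = 0 ∨ ζ' m = 0} := by
  simp only [← Measure.measure_univ_eq_zero]
  exact (ζ.measurable_coe MeasurableSet.univ (measurableSet_singleton 0)).union
    (ζ'.measurable_coe MeasurableSet.univ (measurableSet_singleton 0))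

lemma measurableSet_forall_affine_eq_zero (ζ : Kernel M E) [IsSFiniteKernel ζ]
    (L : Submodule ℝ E) : MeasurableSet {m | ∀ x, ζ m {y | y - x ∈ L} = 0} := by
  have hL : MeasurableSet (L : Set E) := L.closed_of_finiteDimensional.measurableSet
  have hmeas : Measurable fun q : M × E => ζ q.1 {y | y - q.2 ∈ L} := by
    have hS : MeasurableSet {p : (M × E) × E | p.2 - p.1.2 ∈ L} :=
      (measurable_snd.sub (measurable_snd.comp measurable_fst)) hL
    exact Kernel.measurable_kernel_prodMk_left (κ := ζ.comap Prod.fst measurable_fst) hS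
  have heq : {m | ∀ x, ζ m {y | y - x ∈ L} = 0} =
      {m | ∫⁻ x, ζ m {y | y - x ∈ L} ∂ζ m = 0} := by
    ext m
    refine ⟨fun h => ?_, fun h x => ?_⟩
    · rw [mem_ofPred_eq, lintegral_congr (g := fun _ => 0) h, lintegral_zero]
    · by_contra hx
      have hle : ζ m {y | y - x ∈ L} * ζ m {y | y - x ∈ L} ≤
          ∫⁻ z, ζ m {y | y - z ∈ L} ∂ζ m := by
        rw [← setLIntegral_const]
        refine (setLIntegral_mono_ae' ((measurable_sub_const x) hL)
          (ae_of_all _ fun z hz => measure_mono fun y hy => ?_)).trans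
          (setLIntegral_le_lintegral _ _)
        have := L.sub_mem hy hz
        simpa using this
      have h' : ∫⁻ z, ζ m {y | y - z ∈ L} ∂ζ m = 0 := h
      rw [h'] at hle
      exact hx (by simpa using hle)
  rw [heq]
  exact Measurable.lintegral_kernel_prod_right' hmeas (measurableSet_singleton 0)

/-- The matching of two equivariant kernels of the same intensity which do not
charge affine subspaces. -/
theorem exists_matching_of_affine [IsProbabilityMeasure P] (hσ : IsErgodicFlow σ P)
    (hf : SeparatesOrbits σ f) (hζ : IsEquivariantKernel σ ζ) (hζ' : IsEquivariantKernel σ ζ')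
    (hint : ∀ A : Set E, MeasurableSet A → Bornology.IsBounded A →
      ∫⁻ m, ζ m A ∂P = ∫⁻ m, ζ' m A ∂P)
    (hfin : ∀ A : Set E, MeasurableSet A → Bornology.IsBounded A → ∫⁻ m, ζ m A ∂P < ⊤)
    (hzero : (∀ᵐ m ∂P, ∀ x, σ x m = m) → ∀ᵐ m ∂P, ζ m = 0 ∨ ζ' m = 0)
    (haff : ∀ L : Submodule ℝ E, L ≠ ⊤ → ∀ᵐ m ∂P, ∀ x, ζ m {y | y - x ∈ L} = 0)
    (haff' : ∀ L : Submodule ℝ E, L ≠ ⊤ → ∀ᵐ m ∂P, ∀ x, ζ' m {y | y - x ∈ L} = 0) :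
    ∃ F G : M × E → E, Measurable F ∧ Measurable G ∧ IsEquivariantMap σ F ∧
      IsEquivariantMap σ G ∧
      (∀ᵐ m ∂P, (ζ m).map (fun x => F (m, x)) = ζ' m) ∧
      (∀ᵐ m ∂P, (ζ' m).map (fun x => G (m, x)) = ζ m) ∧
      ∀ᵐ m ∂P, ∀ᵐ x ∂(ζ m), G (m, F (m, x)) = x := by
  set L := hσ.invariantSubmodule with hL
  have hN := ae_mem_fixedByAll hσ hf
  by_cases hLtop : L = ⊤
  · have h0 := ae_eq_zero_of_or hσ hζ
      (fun n => hint _ Metric.isOpen_ball.measurableSet Metric.isBounded_ball) (hzero <| by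
      filter_upwards [hN] with m hm x
      exact hm x (by rw [← hL, hLtop]; trivial))
    refine ⟨fun q => q.2, fun q => q.2, measurable_snd, measurable_snd, ?_, ?_, ?_, ?_, ?_⟩
    · intro m x y
      simp
    · intro m x y
      simp
    · filter_upwards [h0.1, h0.2] with m h h'
      rw [h, h', Measure.map_zero]
    · filter_upwards [h0.1, h0.2] with m h h'
      rw [h, h', Measure.map_zero]
    · exact ae_of_all _ fun m => ae_of_all _ fun x => rfl
  obtain ⟨V, hLV⟩ := L.exists_isCompl
  have hVnt : Nontrivial V := by
    rw [Submodule.nontrivial_iff_ne_bot]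
    rintro rfl
    exact hLtop (by simpa using hLV.sup_eq_top)
  set e : E ≃L[ℝ] V × L :=
    (Submodule.prodEquivOfIsCompl V L hLV.symm).symm.toContinuousLinearEquiv with he
  have hes : ∀ z : V × L, e.symm z = (z.1 : E) + z.2 := fun z => by
    rw [e.symm_apply_eq, he, LinearEquiv.coe_toContinuousLinearEquiv', LinearEquiv.eq_symm_apply]
    rfl
  have hNL : ∀ m ∈ fixedByAll σ L, ∀ l : L, σ (e.symm (0, l)) m = m := fun m hm l => by
    rw [hes]
    simpa using hm l l.2
  have hNm := measurableSet_fixedByAll hσ hf L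
  have hNσ := preimage_fixedByAll hσ L
  have hσV := hσ.comp_equiv e hNm hN hNσ hNL
  have hfV : SeparatesOrbits (fun v : V => σ (e.symm (v, 0))) f :=
    ⟨hf.measurable, fun j m => (hf.continuous j m).comp
      (e.symm.continuous.comp (Continuous.prodMk_left 0)), hf.separates⟩
  obtain ⟨ρ, D, β, hD⟩ : ∃ ρ D β, IsBallFamily (fun v : V => σ (e.symm (v, 0))) P ρ D β := by
    rcases exists_annulus_or_line hσV hfV with ⟨r, hr, h⟩ | ⟨v, hv, h⟩
    · obtain ⟨U, hU, hPU, hUr⟩ := exists_clustered hσV hfV h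
      exact ⟨_, exists_ballFamily hσV hU hPU hr hUr⟩
    · have hvL : (v : E) ∈ L := by
        filter_upwards [h] with m hm t
        simpa [hes] using hm t
      have : (v : E) = 0 := Submodule.disjoint_def.1 hLV.disjoint _ hvL v.2
      exact absurd (Subtype.ext this) hv
  obtain ⟨K⟩ : Nonempty (PositiveCompacts L) := inferInstance
  have hatom : ∀ {κ : Kernel M E},
      (∀ L : Submodule ℝ E, L ≠ ⊤ → ∀ᵐ m ∂P, ∀ x, κ m {y | y - x ∈ L} = 0) →
      ∀ᵐ m ∂P, NullSingletonClass (slice e K κ m) := by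
    intro κ h
    filter_upwards [h L hLtop] with m hm
    refine ⟨fun v => ?_⟩
    rw [slice_apply _ _ _ _ (measurableSet_singleton v)]
    refine measure_mono_null (fun y hy => ?_) (hm v)
    have h1 : (e y).1 = v := hy.1
    have h2 : y = ((e y).1 : E) + (e y).2 := by rw [← hes, e.symm_apply_apply]
    rw [mem_ofPred_eq, h2, h1, add_sub_cancel_left]
    exact (e y).2.2
  exact exists_matching_of_slice hσ e K hNm hN hNσ hNL hD hζ hζ' hint hfin (hatom haff)
    (hatom haff')

end Invariance

section Intensity

open ProbabilityTheory TopologicalSpace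

variable {E M : Type*} [NormedAddCommGroup E] [NormedSpace ℝ E] [FiniteDimensional ℝ E]
  [MeasurableSpace E] [BorelSpace E]
  [MeasurableSpace M] {σ : E → M → M} {P : Measure M} {ζ ζ' : Kernel M E}

lemma isAddLeftInvariant_bind (hσ : IsErgodicFlow σ P) (hζ : IsEquivariantKernel σ ζ) :
    (P.bind ζ).IsAddLeftInvariant := by
  refine ⟨fun x => ?_⟩
  ext A hA
  have hxA := measurable_const_add x hA
  rw [Measure.map_apply (measurable_const_add x) hA,
    Measure.bind_apply hxA ζ.measurable.aemeasurable, Measure.bind_apply hA ζ.measurable.aemeasurable]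
  conv_rhs => rw [← (hσ.preserving (-x)).map_eq, lintegral_map (f := fun m => ζ m A)
    (ζ.measurable_coe hA) (hσ.measurable_apply _)]
  refine lintegral_congr fun m => ?_
  rw [hζ.apply_flow, Measure.map_apply (measurable_sub_const _) hA]
  congr 1
  ext y
  simp [add_comm]

lemma bind_lt_top_of_isBounded (hσ : IsErgodicFlow σ P) (hζ : IsEquivariantKernel σ ζ) {C : Set E}
    (hCi : (interior C).Nonempty) (hfin : P.bind ζ C < ⊤) {A : Set E}
    (hA : Bornology.IsBounded A) : P.bind ζ A < ⊤ := by
  have := isAddLeftInvariant_bind hσ hζ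
  exact (measure_mono subset_closure).trans_lt
    (measure_lt_top_of_isCompact_of_isAddLeftInvariant' hCi hfin.ne hA.isCompact_closure)

/-- The mean mass of equivariant kernels is determined by the mean mass of a single set. -/
lemma bind_eq_bind (hσ : IsErgodicFlow σ P) (hζ : IsEquivariantKernel σ ζ)
    (hζ' : IsEquivariantKernel σ ζ') {C : Set E} (hCi : (interior C).Nonempty)
    (hCb : Bornology.IsBounded C) (hfin : P.bind ζ C < ⊤) (hint : P.bind ζ C = P.bind ζ' C) :
    P.bind ζ = P.bind ζ' := by
  obtain ⟨K⟩ : Nonempty (PositiveCompacts E) := inferInstance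
  have hHaar : ∀ {κ : Kernel M E}, IsEquivariantKernel σ κ → P.bind κ C < ⊤ →
      P.bind κ = P.bind κ K • Measure.addHaarMeasure K := by
    intro κ hκ hκC
    have := isAddLeftInvariant_bind hσ hκ
    have : IsFiniteMeasureOnCompacts (P.bind κ) :=
      ⟨fun B hB => bind_lt_top_of_isBounded hσ hκ hCi hκC hB.isBounded⟩
    exact Measure.addHaarMeasure_unique _ K
  have h := hHaar hζ hfin
  have h' := hHaar hζ' (hint ▸ hfin)
  have h0 : Measure.addHaarMeasure K C ≠ 0 :=
    ((isOpen_interior.measure_pos _ hCi).trans_le (measure_mono interior_subset)).ne'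
  have hK : P.bind ζ K = P.bind ζ' K := by
    rw [h, h'] at hint
    simpa [ENNReal.mul_left_inj h0 hCb.measure_lt_top.ne] using hint
  rw [h, h', hK]

end Intensity

lemma isBounded_unitCube (d : ℕ) : Bornology.IsBounded (unitCube d) := by
  have h : Bornology.IsBounded (univ.pi fun _ : Fin d => Set.Icc (0 : ℝ) 1) :=
    Bornology.IsBounded.pi fun _ => Metric.isBounded_Icc 0 1
  refine (((EuclideanSpace.equiv (Fin d) ℝ).symm.lipschitz.isBounded_image h)).subset
    fun x hx => ⟨EuclideanSpace.equiv (Fin d) ℝ x, fun i _ => ⟨(hx i).1, (hx i).2.le⟩, ?_⟩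
  exact ContinuousLinearEquiv.symm_apply_apply _ x

lemma interior_unitCube_nonempty (d : ℕ) : (interior (unitCube d)).Nonempty := by
  refine ⟨WithLp.toLp 2 fun _ => 1 / 2, mem_interior.2
    ⟨⋂ i, {x | x i ∈ Set.Ioo (0 : ℝ) 1}, fun x hx i => ?_, ?_, ?_⟩⟩
  · have := mem_iInter.1 hx i
    exact ⟨this.1.le, this.2⟩
  · exact isOpen_iInter_of_finite fun i => isOpen_Ioo.preimage (by fun_prop)
  · refine mem_iInter.2 fun i => ?_
    constructor <;> norm_num

lemma measurableSet_unitCube (d : ℕ) : MeasurableSet (unitCube d) := by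
  have : unitCube d = ⋂ i, {x | x i ∈ Set.Ico (0 : ℝ) 1} := by
    ext x
    simp [unitCube]
  rw [this]
  exact MeasurableSet.iInter fun i => measurableSet_Ico.preimage (by fun_prop)

lemma DoesNotChargeSmallSets.affine {d : ℕ} {μ : Measure (Eucl d)}
    (hμ : DoesNotChargeSmallSets d μ) {L : Submodule ℝ (Eucl d)} (hL : L ≠ ⊤) (x : Eucl d) :
    μ {y | y - x ∈ L} = 0 := by
  have hlt : Module.finrank ℝ L < d := by
    simpa using Submodule.finrank_lt hL
  obtain ⟨f, hf⟩ : ∃ f : L →ₗ[ℝ] Eucl (d - 1), Function.Injective f := by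
    refine finrank_le_iff_exists_linearMap.1 ?_
    rw [finrank_euclideanSpace_fin]
    omega
  obtain ⟨g, hg⟩ := f.exists_leftInverse_of_injective (LinearMap.ker_eq_bot.2 hf)
  set h : Eucl (d - 1) →L[ℝ] Eucl d := (L.subtype ∘ₗ g).toContinuousLinearMap with hh
  refine measure_mono_null (fun y hy => ?_) (hμ (fun z => x + h z) _
    ((LipschitzWith.const x).add h.lipschitz))
  refine ⟨f ⟨y - x, hy⟩, ?_⟩
  have : g (f ⟨y - x, hy⟩) = ⟨y - x, hy⟩ := LinearMap.congr_fun hg _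
  simp [hh, this]

/-- The pair of random measures as an element of the canonical space. -/
def canonicalPair {d : ℕ} (ξ η : Ω → Measure (Eucl d)) (ω : Ω) :
    BallFinite (Eucl d) × BallFinite (Eucl d) :=
  (BallFinite.ofMeasure (ξ ω), BallFinite.ofMeasure (η ω))

lemma measurable_canonicalPair {Ω : Type*} [MeasurableSpace Ω] {d : ℕ} {ξ η : Ω → Measure (Eucl d)}
    (hξ : Measurable ξ) (hη : Measurable η) : Measurable (canonicalPair ξ η) :=
  (BallFinite.measurable_ofMeasure.comp hξ).prodMk (BallFinite.measurable_ofMeasure.comp hη)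

lemma measurable_uncurry_canonicalPair {Ω : Type*} [MeasurableSpace Ω] {d : ℕ}
    {ξ η : Ω → Measure (Eucl d)} (hξ : Measurable ξ) (hη : Measurable η)
    {F : (BallFinite (Eucl d) × BallFinite (Eucl d)) × Eucl d → Eucl d} (hF : Measurable F) :
    Measurable (Function.uncurry fun ω x => F (canonicalPair ξ η ω, x)) :=
  hF.comp (((measurable_canonicalPair hξ hη).comp measurable_fst).prodMk measurable_snd)

lemma sigmaGen_comm {d : ℕ} (ξ η : Ω → Measure (Eucl d)) : sigmaGen η ξ = sigmaGen ξ η :=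
  sup_comm _ _

lemma canonicalPair_flow {d : ℕ} {θ : Eucl d → Ω → Ω} {ξ η : Ω → Measure (Eucl d)}
    (hξeq : ∀ (ω : Ω) (x : Eucl d), ξ (θ x ω) = Measure.map (fun y => y - x) (ξ ω))
    (hηeq : ∀ (ω : Ω) (x : Eucl d), η (θ x ω) = Measure.map (fun y => y - x) (η ω))
    (x : Eucl d) (ω : Ω) :
    canonicalPair ξ η (θ x ω) = pairFlow x (canonicalPair ξ η ω) := by
  rw [canonicalPair, hξeq, hηeq, BallFinite.ofMeasure_map_sub, BallFinite.ofMeasure_map_sub]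
  rfl

lemma isFactorAllocation_canonicalPair {d : ℕ} {θ : Eucl d → Ω → Ω} {ξ η : Ω → Measure (Eucl d)}
    (hξ : Measurable ξ) (hη : Measurable η)
    (hξeq : ∀ (ω : Ω) (x : Eucl d), ξ (θ x ω) = Measure.map (fun y => y - x) (ξ ω))
    (hηeq : ∀ (ω : Ω) (x : Eucl d), η (θ x ω) = Measure.map (fun y => y - x) (η ω))
    {F : (BallFinite (Eucl d) × BallFinite (Eucl d)) × Eucl d → Eucl d} (hF : Measurable F)
    (hFe : IsEquivariantMap pairFlow F) :
    IsFactorAllocation θ ξ η fun ω x => F (canonicalPair ξ η ω, x) := by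
  refine ⟨measurable_uncurry_canonicalPair hξ hη hF, fun ω x y => ?_, ?_⟩
  · simp only [canonicalPair_flow hξeq hηeq]
    exact hFe _ _ _
  · exact @measurable_uncurry_canonicalPair Ω (sigmaGen ξ η) d ξ η
      ((comap_measurable ξ).mono le_sup_left le_rfl)
      ((comap_measurable η).mono le_sup_right le_rfl) F hF

lemma isErgodicFlow_pairFlow {d : ℕ} {ℙ : Measure Ω} {θ : Eucl d → Ω → Ω}
    {ξ η : Ω → Measure (Eucl d)}
    (hstat : ∀ x : Eucl d, MeasurePreserving (θ x) ℙ ℙ)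
    (herg : ∀ A : Set Ω, MeasurableSet A → (∀ x : Eucl d, θ x ⁻¹' A = A) →
      ℙ A = 0 ∨ ℙ A = 1)
    (hξ : Measurable ξ) (hη : Measurable η)
    (hξeq : ∀ (ω : Ω) (x : Eucl d), ξ (θ x ω) = Measure.map (fun y => y - x) (ξ ω))
    (hηeq : ∀ (ω : Ω) (x : Eucl d), η (θ x ω) = Measure.map (fun y => y - x) (η ω)) :
    IsErgodicFlow pairFlow (ℙ.map (canonicalPair ξ η)) where
  measurable := measurable_pairFlow
  zero m := Prod.ext (BallFinite.translate_zero _) (BallFinite.translate_zero _)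
  add x y m := Prod.ext (BallFinite.translate_add _ _ _) (BallFinite.translate_add _ _ _)
  preserving x := by
    have hπ := measurable_canonicalPair hξ hη
    have hx : Measurable (pairFlow x : BallFinite (Eucl d) × BallFinite (Eucl d) → _) :=
      measurable_pairFlow.comp measurable_prodMk_left
    refine ⟨hx, ?_⟩
    have : pairFlow x ∘ canonicalPair ξ η = canonicalPair ξ η ∘ θ x :=
      funext fun ω => (canonicalPair_flow hξeq hηeq x ω).symm
    rw [Measure.map_map hx hπ, this, ← Measure.map_map hπ (hstat x).measurable, (hstat x).map_eq]
  zero_one A hA hinv := by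
    have hπ := measurable_canonicalPair hξ hη
    rw [Measure.map_apply hπ hA]
    refine herg _ (hπ hA) fun x => ?_
    rw [← preimage_comp, show canonicalPair ξ η ∘ θ x = pairFlow x ∘ canonicalPair ξ η from
      funext fun ω => canonicalPair_flow hξeq hηeq x ω, preimage_comp, hinv]

/-- If `ξ` and `η` are a.s. mutually singular and both do not charge small sets, then
there exist factor allocations `T` (balancing `ξ, η`) and `S` (balancing `η, ξ`) which
are a.s. inverse to each other `ξ`-a.e. -/
theorem factor_allocation_with_inverse
    {d : ℕ} (hd : 1 ≤ d)
    (ℙ : Measure Ω) [IsProbabilityMeasure ℙ]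
    (θ : Eucl d → Ω → Ω)
    (hθmeas : Measurable fun p : Eucl d × Ω => θ p.1 p.2)
    (hθ0 : ∀ ω, θ 0 ω = ω)
    (hθadd : ∀ (x y : Eucl d) (ω : Ω), θ y (θ x ω) = θ (x + y) ω)
    (hstat : ∀ x : Eucl d, MeasurePreserving (θ x) ℙ ℙ)
    (herg : ∀ A : Set Ω, MeasurableSet A → (∀ x : Eucl d, θ x ⁻¹' A = A) →
      ℙ A = 0 ∨ ℙ A = 1)
    (ξ η : Ω → Measure (Eucl d))
    (hξm : ∀ B : Set (Eucl d), MeasurableSet B → Measurable fun ω => ξ ω B)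
    (hηm : ∀ B : Set (Eucl d), MeasurableSet B → Measurable fun ω => η ω B)
    (hξloc : ∀ᵐ ω ∂ℙ, ∀ K : Set (Eucl d), IsCompact K → ξ ω K < ⊤)
    (hηloc : ∀ᵐ ω ∂ℙ, ∀ K : Set (Eucl d), IsCompact K → η ω K < ⊤)
    (hξeq : ∀ (ω : Ω) (x : Eucl d), ξ (θ x ω) = Measure.map (fun y => y - x) (ξ ω))
    (hηeq : ∀ (ω : Ω) (x : Eucl d), η (θ x ω) = Measure.map (fun y => y - x) (η ω))
    (hfin : ∫⁻ ω, ξ ω (unitCube d) ∂ℙ < ⊤)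
    (hint : ∫⁻ ω, ξ ω (unitCube d) ∂ℙ = ∫⁻ ω, η ω (unitCube d) ∂ℙ)
    (hsing : ∀ᵐ ω ∂ℙ, Measure.MutuallySingular (ξ ω) (η ω))
    (hξsmall : ∀ᵐ ω ∂ℙ, DoesNotChargeSmallSets d (ξ ω))
    (hηsmall : ∀ᵐ ω ∂ℙ, DoesNotChargeSmallSets d (η ω)) :
    ∃ (T S : Ω → Eucl d → Eucl d),
      IsFactorAllocation θ ξ η T ∧
      IsFactorAllocation θ η ξ S ∧
      (∀ᵐ ω ∂ℙ, Measure.map (T ω) (ξ ω) = η ω) ∧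
      (∀ᵐ ω ∂ℙ, Measure.map (S ω) (η ω) = ξ ω) ∧
      (∀ᵐ ω ∂ℙ, ∀ᵐ x ∂(ξ ω), S ω (T ω x) = x) := by
  have hξ : Measurable ξ := Measure.measurable_of_measurable_coe _ hξm
  have hη : Measurable η := Measure.measurable_of_measurable_coe _ hηm
  have hπ := measurable_canonicalPair hξ hη
  set P := ℙ.map (canonicalPair ξ η) with hP
  have : IsProbabilityMeasure P := Measure.isProbabilityMeasure_map hπ.aemeasurable
  have hσ : IsErgodicFlow pairFlow P := isErgodicFlow_pairFlow hstat herg hξ hη hξeq hηeq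
  have hval : ∀ {κ : Ω → Measure (Eucl d)},
      (∀ᵐ ω ∂ℙ, ∀ K : Set (Eucl d), IsCompact K → κ ω K < ⊤) →
      ∀ᵐ ω ∂ℙ, (BallFinite.ofMeasure (κ ω)).1 = κ ω := by
    intro κ h
    filter_upwards [h] with ω hω
    exact BallFinite.ofMeasure_val fun n =>
      (measure_mono Metric.ball_subset_closedBall).trans_lt (hω _ (isCompact_closedBall 0 _))
  have hξv := hval hξloc
  have hηv := hval hηloc
  set ζ : ProbabilityTheory.Kernel (BallFinite (Eucl d) × BallFinite (Eucl d)) (Eucl d) :=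
    (BallFinite.kernel (Eucl d)).comap Prod.fst measurable_fst with hζdef
  set ζ' : ProbabilityTheory.Kernel (BallFinite (Eucl d) × BallFinite (Eucl d)) (Eucl d) :=
    (BallFinite.kernel (Eucl d)).comap Prod.snd measurable_snd with hζ'def
  have hζ : IsEquivariantKernel pairFlow ζ :=
    ⟨fun m r => BallFinite.kernel_ball_lt_top m.1 r, fun x m => rfl⟩
  have hζ' : IsEquivariantKernel pairFlow ζ' :=
    ⟨fun m r => BallFinite.kernel_ball_lt_top m.2 r, fun x m => rfl⟩
  have hbind : ∀ A, MeasurableSet A → P.bind ζ A = ∫⁻ ω, ξ ω A ∂ℙ := by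
    intro A hA
    rw [Measure.bind_apply hA ζ.measurable.aemeasurable, hP,
      lintegral_map (f := fun m => ζ m A) (ζ.measurable_coe hA) hπ]
    exact lintegral_congr_ae (hξv.mono fun ω hω => congrArg (fun μ : Measure (Eucl d) => μ A) hω)
  have hbind' : ∀ A, MeasurableSet A → P.bind ζ' A = ∫⁻ ω, η ω A ∂ℙ := by
    intro A hA
    rw [Measure.bind_apply hA ζ'.measurable.aemeasurable, hP,
      lintegral_map (f := fun m => ζ' m A) (ζ'.measurable_coe hA) hπ]
    exact lintegral_congr_ae (hηv.mono fun ω hω => congrArg (fun μ : Measure (Eucl d) => μ A) hω)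
  have hCm := measurableSet_unitCube d
  have hCfin : P.bind ζ (unitCube d) < ⊤ := by rwa [hbind _ hCm]
  have hCint : P.bind ζ (unitCube d) = P.bind ζ' (unitCube d) := by
    rw [hbind _ hCm, hbind' _ hCm, hint]
  have hCi := interior_unitCube_nonempty d
  have hbb := bind_eq_bind hσ hζ hζ' hCi (isBounded_unitCube d) hCfin hCint
  have hbA : ∀ {κ : ProbabilityTheory.Kernel (BallFinite (Eucl d) × BallFinite (Eucl d)) (Eucl d)}
      {A : Set (Eucl d)}, MeasurableSet A → P.bind κ A = ∫⁻ m, κ m A ∂P := fun hA =>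
    Measure.bind_apply hA (ProbabilityTheory.Kernel.measurable _).aemeasurable
  have := hζ.isSFiniteKernel
  have := hζ'.isSFiniteKernel
  obtain ⟨f, hf⟩ := exists_separatesOrbits_pairFlow (E := Eucl d)
  obtain ⟨F, G, hF, hG, hFe, hGe, hFm, hGm, hGF⟩ := exists_matching_of_affine hσ hf hζ hζ'
    (fun A hA _ => by rw [← hbA hA, ← hbA hA, hbb])
    (fun A hA hAb => by
      rw [← hbA hA]
      exact bind_lt_top_of_isBounded hσ hζ hCi hCfin hAb)
    (fun h => by
      rw [hP, ae_map_iff hπ.aemeasurable (measurableSet_eq_zero_or_eq_zero ζ ζ')]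
      filter_upwards [ae_of_ae_map hπ.aemeasurable h, hξv, hηv, hsing] with ω hω h1 h2 hs
      exact hζ.eq_zero_or_eq_zero hζ' hω (by rwa [← h1, ← h2] at hs))
    (fun L hL => by
      rw [hP, ae_map_iff hπ.aemeasurable (measurableSet_forall_affine_eq_zero ζ L)]
      filter_upwards [hξv, hξsmall] with ω h1 hs x
      rw [← h1] at hs
      exact hs.affine hL x)
    (fun L hL => by
      rw [hP, ae_map_iff hπ.aemeasurable (measurableSet_forall_affine_eq_zero ζ' L)]
      filter_upwards [hηv, hηsmall] with ω h1 hs x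
      rw [← h1] at hs
      exact hs.affine hL x)
  refine ⟨fun ω x => F (canonicalPair ξ η ω, x), fun ω x => G (canonicalPair ξ η ω, x),
    isFactorAllocation_canonicalPair hξ hη hξeq hηeq hF hFe, ?_, ?_, ?_, ?_⟩
  · have h := isFactorAllocation_canonicalPair hξ hη hξeq hηeq hG hGe
    rw [IsFactorAllocation, sigmaGen_comm]
    exact h
  · filter_upwards [ae_of_ae_map hπ.aemeasurable hFm, hξv, hηv] with ω h h1 h2
    rw [← h1, ← h2]
    exact h
  · filter_upwards [ae_of_ae_map hπ.aemeasurable hGm, hξv, hηv] with ω h h1 h2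
    rw [← h1, ← h2]
    exact h
  · filter_upwards [ae_of_ae_map hπ.aemeasurable hGF, hξv] with ω h h1
    rw [← h1]
    exact h
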